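/- arXiv:2506.00699 — 3 statements merged into one kernel-verified Lean document; each statement's English description precedes it below -/
import Mathlib

section
/- For every n ≥ 1, the canonical projection S(n+1) → S(n), u ↦ u_*, satisfies ((id_1×σ)·u·(id_1×τ))_* = σ·u_*·τ for all u ∈ S(n+1) and all σ, τ ∈ S(n). Moreover, if n ≥ 4, then u ↦ u_* is the unique map f: S(n+1) → S(n) satisfying f((id_1×σ)·u·(id_1×τ)) = σ·f(u)·τ for all u ∈ S(n+1) and all σ, τ ∈ S(n). -/
/-!
Statement 2: the canonical projection `S(n+1) → S(n)`, `u ↦ u_*`, is equivariant for the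
two-sided `S(n)`-action through the embedding `w ↦ id_1 × w` (fixing the first letter), and for
`n ≥ 4` it is the unique map with this property.

Indexing `Fin (n+1) = {0,…,n}`, the embedding `id_1 × w` fixes `0` and sends `i+1 ↦ w i + 1`;
the projection `u ↦ u_*` satisfies `u_* i = u (i+1) - 1` if `u (i+1) ≠ 0` and `u_* i = u 0 - 1`
if `u (i+1) = 0` (delete `0` from its cycle and relabel); this is exactly
`Equiv.removeNone` of `u` conjugated by `finSuccEquiv : Fin (n+1) ≃ Option (Fin n)`
(which sends `0 ↦ none`, `i+1 ↦ some i`).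
-/

noncomputable section

open Equiv

/-- The embedding `S(n) → S(n+1)`, `w ↦ id_1 × w`, fixing `0` and sending `i+1 ↦ w i + 1`. -/
def embedSucc {n : ℕ} (w : Equiv.Perm (Fin n)) : Equiv.Perm (Fin (n + 1)) :=
  ((finSuccEquiv n).symm).permCongr (Equiv.optionCongr w)

/-- The canonical projection `S(n+1) → S(n)`, `u ↦ u_*`:  `u_* i = u (i+1) - 1` if
`u (i+1) ≠ 0`, and `u_* i = u 0 - 1` if `u (i+1) = 0`. -/
def projSucc {n : ℕ} (u : Equiv.Perm (Fin (n + 1))) : Equiv.Perm (Fin n) :=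
  Equiv.removeNone (((finSuccEquiv n).symm.trans u).trans (finSuccEquiv n))

theorem embedSucc_zero' {n : ℕ} (w : Equiv.Perm (Fin n)) : embedSucc w 0 = 0 := by
  simp [embedSucc, Equiv.permCongr_apply]

theorem embedSucc_succ' {n : ℕ} (w : Equiv.Perm (Fin n)) (i : Fin n) :
    embedSucc w i.succ = (w i).succ := by
  simp [embedSucc, Equiv.permCongr_apply]

theorem projSucc_spec {n : ℕ} (u : Equiv.Perm (Fin (n + 1))) (i : Fin n) :
    (projSucc u i).succ = if u i.succ = 0 then u 0 else u i.succ := by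
  have key : ∀ e : Option (Fin n) ≃ Option (Fin n),
      some (Equiv.removeNone e i) = if e (some i) = none then e none else e (some i) := by
    intro e
    split_ifs with h
    · exact Equiv.removeNone_none e h
    · exact Equiv.removeNone_some e (Option.ne_none_iff_exists'.mp h)
  have k := key (((finSuccEquiv n).symm.trans u).trans (finSuccEquiv n))
  have k2 := congrArg (finSuccEquiv n).symm k
  have hz : ∀ x : Fin (n + 1), finSuccEquiv n x = none ↔ x = 0 := by
    intro x
    rw [← finSuccEquiv_zero, (finSuccEquiv n).apply_eq_iff_eq]
  simp only [finSuccEquiv_symm_some, Equiv.trans_apply, hz, finSuccEquiv_symm_none] at k2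
  rw [projSucc, k2]
  split_ifs <;> simp

theorem embedSucc_eq_zero' {n : ℕ} (w : Equiv.Perm (Fin n)) (x : Fin (n + 1)) :
    embedSucc w x = 0 ↔ x = 0 := by
  conv_lhs => rw [← embedSucc_zero' w]
  exact (embedSucc w).apply_eq_iff_eq

theorem projSucc_equiv' {n : ℕ} (u : Equiv.Perm (Fin (n + 1))) (σ τ : Equiv.Perm (Fin n)) :
    projSucc (embedSucc σ * u * embedSucc τ) = σ * projSucc u * τ := by
  refine Equiv.ext fun i => ?_
  apply Fin.succ_injective
  rw [projSucc_spec]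
  simp only [Equiv.Perm.mul_apply, embedSucc_zero', embedSucc_succ', embedSucc_eq_zero']
  rw [← embedSucc_succ' σ, projSucc_spec]
  split_ifs <;> rfl

theorem embedSucc_projSucc' {n : ℕ} (v : Equiv.Perm (Fin (n + 1))) (hv : v 0 = 0) :
    embedSucc (projSucc v) = v := by
  refine Equiv.ext fun x => ?_
  refine Fin.cases ?_ (fun i => ?_) x
  · rw [embedSucc_zero', hv]
  · rw [embedSucc_succ', projSucc_spec, if_neg]
    intro h
    exact Fin.succ_ne_zero i (v.injective (h.trans hv.symm))

theorem eq_one_of_commute' {n : ℕ} (hn : 4 ≤ n) (a : Fin n) (h : Equiv.Perm (Fin n))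
    (hc : ∀ σ : Equiv.Perm (Fin n), σ a = a → σ * h = h * σ) : h = 1 := by
  have h1 : ∀ x, x ≠ a → h x = x := by
    intro x hx
    by_contra hne
    obtain ⟨z, hz⟩ : ∃ z, z ∉ ({a, x, h x} : Finset (Fin n)) := by
      by_contra! hall
      have h3 : ({a, x, h x} : Finset (Fin n)).card ≤ 3 := Finset.card_le_three
      rw [Finset.eq_univ_iff_forall.mpr hall, Finset.card_univ, Fintype.card_fin] at h3
      omega
    simp only [Finset.mem_insert, Finset.mem_singleton, not_or] at hz
    obtain ⟨hza, hzx, hzh⟩ := hz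
    have := hc (Equiv.swap x z) (Equiv.swap_apply_of_ne_of_ne hx.symm (Ne.symm hza))
    have := congrArg (fun p : Equiv.Perm (Fin n) => p x) this
    simp only [Equiv.Perm.mul_apply, Equiv.swap_apply_left] at this
    rw [Equiv.swap_apply_of_ne_of_ne hne (Ne.symm hzh)] at this
    exact hzx (h.injective this).symm
  refine Equiv.ext fun x => ?_
  by_cases hx : x = a
  · subst hx
    by_contra hne
    exact hne (h.injective (h1 _ hne))
  · exact h1 x hx

theorem projSucc_equivariant_and_unique (n : ℕ) (hn : 1 ≤ n) :
    (∀ (u : Equiv.Perm (Fin (n + 1))) (σ τ : Equiv.Perm (Fin n)),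
        projSucc (embedSucc σ * u * embedSucc τ) = σ * projSucc u * τ)
    ∧ (4 ≤ n →
        ∀ f : Equiv.Perm (Fin (n + 1)) → Equiv.Perm (Fin n),
          (∀ (u : Equiv.Perm (Fin (n + 1))) (σ τ : Equiv.Perm (Fin n)),
              f (embedSucc σ * u * embedSucc τ) = σ * f u * τ) →
          f = projSucc) := by
  refine ⟨projSucc_equiv', fun h4 f hf => ?_⟩
  funext u
  obtain ⟨a, ha⟩ : ∃ a : Fin n, ∀ σ : Equiv.Perm (Fin n), σ a = a →
      embedSucc σ (u 0) = u 0 := by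
    refine Fin.cases (motive := fun x => ∃ a : Fin n, ∀ σ : Equiv.Perm (Fin n), σ a = a →
      embedSucc σ x = x) ?_ (fun i => ?_) (u 0)
    · exact ⟨⟨0, hn⟩, fun σ _ => embedSucc_zero' σ⟩
    · exact ⟨i, fun σ h => by rw [embedSucc_succ', h]⟩
  have h1 : f u * (projSucc u)⁻¹ = 1 := by
    apply eq_one_of_commute' h4 a
    intro σ hσ
    have hv : (u⁻¹ * embedSucc σ * u) 0 = 0 := by
      simp only [Equiv.Perm.mul_apply]
      rw [ha σ hσ]; simp
    have e := embedSucc_projSucc' _ hv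
    generalize projSucc (u⁻¹ * embedSucc σ * u) = τ at e
    have one : embedSucc (1 : Equiv.Perm (Fin n)) = 1 := by
      refine Equiv.ext fun x => ?_
      refine Fin.cases ?_ (fun i => ?_) x
      · rw [embedSucc_zero']; rfl
      · rw [embedSucc_succ']; rfl
    have e2 : embedSucc σ * u * embedSucc 1 = embedSucc 1 * u * embedSucc τ := by
      rw [e, one]; group
    have ef := hf u σ 1
    rw [e2, hf] at ef
    have ep := projSucc_equiv' u σ 1
    rw [e2, projSucc_equiv'] at ep
    simp only [one_mul, mul_one] at ef ep
    calc σ * (f u * (projSucc u)⁻¹) = (σ * f u) * (projSucc u)⁻¹ := by group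
      _ = f u * (projSucc u)⁻¹ * (projSucc u * τ) * (projSucc u)⁻¹ := by rw [← ef]; group
      _ = f u * (projSucc u)⁻¹ * σ := by rw [ep]; group
  exact mul_inv_eq_one.mp h1

end
end

section
/- The subspace I_N — the k-linear span of the elements (a) π(α)⊗X − α⊗(tr⊗X) for α ∈ O(A)^(n) with n ≥ 1 and X ∈ Mat_N^*(k)^⊗(n−1); (b) 1̂(α)⊗X − α⊗ε_1(X) for α ∈ O(A)^(n) and X ∈ Mat_N^*(k)^⊗(n+1); (c) (σ·α)⊗E*_{ij} − α⊗E*_{i,σ⁻¹(j)} and (α·σ)⊗E*_{ij} − α⊗E*_{σ(i),j} for α ∈ O(A)^(n), σ ∈ S(n), and tuples i, j ∈ {1,…,N}^n, where σ(i) := (i_{σ⁻¹(1)},…,i_{σ⁻¹(n)}) and σ⁻¹(j) := (j_{σ(1)},…,j_{σ(n)}) — is a two-sided ideal of the algebra O(A) ⊙ T(Mat_N^*(k)). -/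
noncomputable section

set_option maxHeartbeats 1000000
set_option synthInstance.maxHeartbeats 100000

open TensorProduct PiTensorProduct Equiv Function

variable (k : Type*) [Field k]
variable (A : Type*) [Ring A] [Algebra k A]

/-- The commutator subspace `[A,A] ⊆ A`. -/
def commSM : Submodule k A := Submodule.span k {x : A | ∃ a b : A, x = a * b - b * a}

/-- `A_♮ = A/[A,A]`. -/
abbrev Anat := A ⧸ commSM k A

/-- The quotient map `A → A_♮`. -/
def qNat : A →ₗ[k] Anat k A := (commSM k A).mkQ

/-- The symmetrizing relation on the tensor algebra of `A_♮`. -/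
def symRel : TensorAlgebra k (Anat k A) → TensorAlgebra k (Anat k A) → Prop :=
  fun u v => ∃ x y : TensorAlgebra k (Anat k A), u = x * y ∧ v = y * x

/-- The symmetric algebra `Sym(A_♮)`, realized as the quotient of the tensor algebra of `A_♮`
by the relations `xy = yx`. -/
abbrev SymA := RingQuot (symRel k A)

/-- The canonical inclusion `A_♮ → Sym(A_♮)`. -/
def iotaSym : Anat k A →ₗ[k] SymA k A :=
  (RingQuot.mkAlgHom k (symRel k A)).toLinearMap ∘ₗ TensorAlgebra.ι k

/-- Tensor powers of `A`. -/
abbrev TP (n : ℕ) := PiTensorProduct k (fun _ : Fin n => A)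

/-- The group algebra `k[S(n)]`, as the free `k`-module on `S(n)`. -/
abbrev GrpAlg (n : ℕ) := Equiv.Perm (Fin n) →₀ k

/-- The `n`-th graded component `O(A)^{(n)} = A^{⊗n} ⊗ Sym(A_♮) ⊗ k[S(n)]`. -/
abbrev OO (n : ℕ) := (TP k A n ⊗[k] SymA k A) ⊗[k] GrpAlg k n

/-- The pure element `(a_1 ⊗ ⋯ ⊗ a_n) ⊗ f ⊗ u` of `O(A)^{(n)}`. -/
def el {n : ℕ} (a : Fin n → A) (f : SymA k A) (u : Equiv.Perm (Fin n)) : OO k A n :=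
  (tprod k a ⊗ₜ[k] f) ⊗ₜ[k] Finsupp.single u 1

/-- Build a linear map out of `O(A)^{(n)}` from a family of linear maps on
`A^{⊗n} ⊗ Sym(A_♮)` indexed by permutations. -/
def build {n : ℕ} {M : Type*} [AddCommMonoid M] [Module k M]
    (F : Equiv.Perm (Fin n) → ((TP k A n ⊗[k] SymA k A) →ₗ[k] M)) :
    OO k A n →ₗ[k] M :=
  TensorProduct.lift
    ((Finsupp.lift ((TP k A n ⊗[k] SymA k A) →ₗ[k] M) k (Equiv.Perm (Fin n)) F).flip)

/-- Splitting off the first tensor factor. -/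
def splitFirst (M : Type*) [AddCommGroup M] [Module k M] (n : ℕ) :
    PiTensorProduct k (fun _ : Fin (n+1) => M) ≃ₗ[k]
      M ⊗[k] PiTensorProduct k (fun _ : Fin n => M) :=
  (PiTensorProduct.reindex k (fun _ : Fin (n+1) => M)
      ((finSumFinEquiv.trans (finCongr (by omega : 1 + n = n + 1))).symm :
        Fin (n+1) ≃ (Fin 1 ⊕ Fin n))).trans
    ((PiTensorProduct.tmulEquiv k M).symm.trans
      (TensorProduct.congr (PiTensorProduct.subsingletonEquiv (0 : Fin 1))
        (LinearEquiv.refl k _)))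

/-- Left multiplication into the `s`-th factor of a tensor power of `A`:
`a₀ ⊗ (b_1 ⊗ ⋯ ⊗ b_n) ↦ b_1 ⊗ ⋯ ⊗ (a₀ * b_s) ⊗ ⋯ ⊗ b_n`. -/
def mulInto : ∀ {n : ℕ}, Fin n → (A ⊗[k] TP k A n →ₗ[k] TP k A n)
  | 0, s => s.elim0
  | (m+1), s =>
    (PiTensorProduct.reindex k (fun _ : Fin (m+1) => A)
        (((Fin.cycleRange s)⁻¹ : Equiv.Perm (Fin (m+1))) : Fin (m+1) ≃ Fin (m+1))).toLinearMap ∘ₗ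
    (splitFirst k A m).symm.toLinearMap ∘ₗ
    LinearMap.rTensor (TP k A m) (LinearMap.mul' k A) ∘ₗ
    (TensorProduct.assoc k A A (TP k A m)).symm.toLinearMap ∘ₗ
    LinearMap.lTensor A
      (((PiTensorProduct.reindex k (fun _ : Fin (m+1) => A)
        ((Fin.cycleRange s : Equiv.Perm (Fin (m+1))) : Fin (m+1) ≃ Fin (m+1))).trans
        (splitFirst k A m)).toLinearMap)

/-- Multiplication `A ⊗ Sym(A_♮) → Sym(A_♮)`, `a ⊗ f ↦ ā · f`. -/
def mulSym : A ⊗[k] SymA k A →ₗ[k] SymA k A :=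
  LinearMap.mul' k (SymA k A) ∘ₗ
    LinearMap.rTensor (SymA k A) (iotaSym k A ∘ₗ qNat k A)

/-- Tensoring with a fixed group-algebra basis vector: `x ↦ x ⊗ u`. -/
def withPerm {n : ℕ} (u : Equiv.Perm (Fin n)) :
    (TP k A n ⊗[k] SymA k A) →ₗ[k] OO k A n :=
  (TensorProduct.mk k (TP k A n ⊗[k] SymA k A) (GrpAlg k n)).flip (Finsupp.single u 1)

/-- The case `u(1) = 1` of `π`. -/
def piCaseOne {n : ℕ} (u : Equiv.Perm (Fin (n+1))) :
    (TP k A (n+1) ⊗[k] SymA k A) →ₗ[k] OO k A n :=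
  withPerm k A (projSucc u) ∘ₗ
  LinearMap.lTensor (TP k A n) (mulSym k A) ∘ₗ
  (TensorProduct.leftComm k A (TP k A n) (SymA k A)).toLinearMap ∘ₗ
  (TensorProduct.assoc k A (TP k A n) (SymA k A)).toLinearMap ∘ₗ
  LinearMap.rTensor (SymA k A) (splitFirst k A n).toLinearMap

/-- The case `u(1) = s > 1` of `π`. -/
def piCaseTwo {n : ℕ} (u : Equiv.Perm (Fin (n+1))) (h : u 0 ≠ 0) :
    (TP k A (n+1) ⊗[k] SymA k A) →ₗ[k] OO k A n :=
  withPerm k A (projSucc u) ∘ₗ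
  LinearMap.rTensor (SymA k A) (mulInto k A ((u 0).pred h)) ∘ₗ
  LinearMap.rTensor (SymA k A) (splitFirst k A n).toLinearMap

/-- The map `π : O(A)^{(n+1)} → O(A)^{(n)}`. -/
def piMap {n : ℕ} : OO k A (n+1) →ₗ[k] OO k A n :=
  build k A (fun u => if h : u 0 = 0 then piCaseOne k A u else piCaseTwo k A u h)

/-- Prepending a tensor factor `1`. -/
def consOne {n : ℕ} : TP k A n →ₗ[k] TP k A (n+1) :=
  (splitFirst k A n).symm.toLinearMap ∘ₗ TensorProduct.mk k A (TP k A n) 1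

/-- The map `1̂ : O(A)^{(n)} → O(A)^{(n+1)}`. -/
def oneHat {n : ℕ} : OO k A n →ₗ[k] OO k A (n+1) :=
  build k A (fun u =>
    withPerm k A (embedSucc u) ∘ₗ LinearMap.rTensor (SymA k A) (consOne k A))

/-- The left action of `σ ∈ S(n)` on `O(A)^{(n)}`:
`σ·((a_1⊗…⊗a_n)⊗f⊗τ) = (a_{σ⁻¹(1)}⊗…⊗a_{σ⁻¹(n)})⊗f⊗(στ)`. -/
def lAct {n : ℕ} (σ : Equiv.Perm (Fin n)) : OO k A n →ₗ[k] OO k A n :=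
  build k A (fun u =>
    withPerm k A (σ * u) ∘ₗ
      LinearMap.rTensor (SymA k A)
        (PiTensorProduct.reindex k (fun _ : Fin n => A)
          (σ : Fin n ≃ Fin n)).toLinearMap)

/-- The right action of `σ ∈ S(n)` on `O(A)^{(n)}`:
`((a_1⊗…⊗a_n)⊗f⊗τ)·σ = (a_1⊗…⊗a_n)⊗f⊗(τσ)`. -/
def rAct {n : ℕ} (σ : Equiv.Perm (Fin n)) : OO k A n →ₗ[k] OO k A n :=
  LinearMap.lTensor (TP k A n ⊗[k] SymA k A)
    (Finsupp.lmapDomain k k (fun u : Equiv.Perm (Fin n) => u * σ))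

end

noncomputable section

set_option maxHeartbeats 1000000
set_option synthInstance.maxHeartbeats 400000

open TensorProduct PiTensorProduct

variable (k : Type*) [Field k]
variable (A : Type*) [Ring A] [Algebra k A]
variable (N : ℕ)

/-- The dual `Mat_N^*(k)` of the space of `N×N` matrices. -/
abbrev MatD := Module.Dual k (Matrix (Fin N) (Fin N) k)

/-- Tensor powers of `Mat_N^*(k)`. -/
abbrev TM (n : ℕ) := PiTensorProduct k (fun _ : Fin n => MatD k N)

/-- The `n`-th graded component `O(A)^{(n)} ⊗ (Mat_N^*(k))^{⊗n}` of the Hadamard product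
`O(A) ⊙ T(Mat_N^*(k))`. -/
abbrev Hn (n : ℕ) := OO k A n ⊗[k] TM k N n

instance (n : ℕ) : AddCommGroup (Hn k A N n) := Module.addCommMonoidToAddCommGroup k

/-- The Hadamard product `O(A) ⊙ T(Mat_N^*(k)) = ⊕_n O(A)^{(n)} ⊗ (Mat_N^*(k))^{⊗n}`. -/
abbrev HH := DirectSum ℕ (fun n => Hn k A N n)

instance : AddCommGroup (HH k A N) := Module.addCommMonoidToAddCommGroup k

/-- Concatenation of tensor powers. -/
def catPow (M : Type*) [AddCommGroup M] [Module k M] (n m : ℕ) :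
    (PiTensorProduct k (fun _ : Fin n => M) ⊗[k] PiTensorProduct k (fun _ : Fin m => M))
      ≃ₗ[k] PiTensorProduct k (fun _ : Fin (n + m) => M) :=
  (PiTensorProduct.tmulEquiv k M).trans
    (PiTensorProduct.reindex k (fun _ : Fin n ⊕ Fin m => M) finSumFinEquiv)

/-- The juxtaposition `u × v` of permutations. -/
def juxt2 {n m : ℕ} (u : Equiv.Perm (Fin n)) (v : Equiv.Perm (Fin m)) :
    Equiv.Perm (Fin (n + m)) :=
  finSumFinEquiv.permCongr (Equiv.sumCongr u v)

/-- Multiplication of group-algebra components: `u ⊗ v ↦ u × v`. -/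
def grpMul (n m : ℕ) : GrpAlg k n ⊗[k] GrpAlg k m →ₗ[k] GrpAlg k (n + m) :=
  TensorProduct.lift
    (Finsupp.lift (GrpAlg k m →ₗ[k] GrpAlg k (n + m)) k (Equiv.Perm (Fin n)) (fun u =>
      Finsupp.lift (GrpAlg k (n + m)) k (Equiv.Perm (Fin m)) (fun v =>
        Finsupp.single (juxt2 u v) 1)))

/-- The graded multiplication of `O(A)`:
`((a)⊗f₁⊗τ₁)·((b)⊗f₂⊗τ₂) = (a ⊗ b)⊗(f₁f₂)⊗(τ₁×τ₂)`. -/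
def mulOO (n m : ℕ) : (OO k A n ⊗[k] OO k A m) →ₗ[k] OO k A (n + m) :=
  (TensorProduct.map
    ((TensorProduct.map (catPow k A n m).toLinearMap (LinearMap.mul' k (SymA k A))) ∘ₗ
      (TensorProduct.tensorTensorTensorComm k (TP k A n) (SymA k A)
        (TP k A m) (SymA k A)).toLinearMap)
    (grpMul k n m)) ∘ₗ
  (TensorProduct.tensorTensorTensorComm k (TP k A n ⊗[k] SymA k A) (GrpAlg k n)
    (TP k A m ⊗[k] SymA k A) (GrpAlg k m)).toLinearMap

/-- The graded multiplication of the Hadamard product. -/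
def mulHn (n m : ℕ) : (Hn k A N n ⊗[k] Hn k A N m) →ₗ[k] Hn k A N (n + m) :=
  (TensorProduct.map (mulOO k A n m) (catPow k (MatD k N) n m).toLinearMap) ∘ₗ
    (TensorProduct.tensorTensorTensorComm k (OO k A n) (TM k N n)
      (OO k A m) (TM k N m)).toLinearMap

/-- The multiplication of the Hadamard product `O(A) ⊙ T(Mat_N^*(k))`, as a bilinear map. -/
def mulH : HH k A N →ₗ[k] HH k A N →ₗ[k] HH k A N :=
  DirectSum.toModule k ℕ (HH k A N →ₗ[k] HH k A N) (fun n =>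
    (DirectSum.toModule k ℕ (Hn k A N n →ₗ[k] HH k A N) (fun m =>
      ((TensorProduct.curry (mulHn k A N n m)).compr₂
        (DirectSum.lof k ℕ (fun p => Hn k A N p) (n + m))).flip)).flip)

/-- The trace functional, as an element of `Mat_N^*(k)`. -/
def trDual : MatD k N := Matrix.traceLinearMap (Fin N) k k

/-- Evaluation at the identity matrix `ε : Mat_N^*(k) → k`. -/
def evalOne : MatD k N →ₗ[k] k where
  toFun φ := φ 1
  map_add' _ _ := rfl
  map_smul' _ _ := rfl

/-- `ε_1 : (Mat_N^*)^{⊗(n+1)} → (Mat_N^*)^{⊗n}`, applying `ε` to the first factor. -/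
def epsFirst (n : ℕ) : TM k N (n + 1) →ₗ[k] TM k N n :=
  (TensorProduct.lid k (TM k N n)).toLinearMap ∘ₗ
    (TensorProduct.map (evalOne k N) LinearMap.id) ∘ₗ
    (splitFirst k (MatD k N) n).toLinearMap

/-- `tr ⊗ X ∈ (Mat_N^*)^{⊗(n+1)}`. -/
def consTr (n : ℕ) (Xm : TM k N n) : TM k N (n + 1) :=
  (splitFirst k (MatD k N) n).symm (trDual k N ⊗ₜ[k] Xm)

/-- The matrix-unit dual functional `E*_{pq}`. -/
def Estar (p q : Fin N) : MatD k N where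
  toFun M := M p q
  map_add' _ _ := rfl
  map_smul' _ _ := rfl

/-- The pure dual tensor `E*_{ij} = E*_{i_1 j_1} ⊗ ⋯ ⊗ E*_{i_n j_n}`. -/
def Epure {n : ℕ} (i j : Fin n → Fin N) : TM k N n :=
  tprod k (fun t => Estar k N (i t) (j t))

/-- The generating set of the ideal `I_N` of `O(A) ⊙ T(Mat_N^*(k))`. -/
def ISet : Set (HH k A N) :=
  {z | (∃ (n : ℕ) (α : OO k A (n + 1)) (Xm : TM k N n),
          z = DirectSum.lof k ℕ (fun p => Hn k A N p) n ((piMap k A α) ⊗ₜ[k] Xm) -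
              DirectSum.lof k ℕ (fun p => Hn k A N p) (n + 1) (α ⊗ₜ[k] consTr k N n Xm)) ∨
       (∃ (n : ℕ) (α : OO k A n) (Xm : TM k N (n + 1)),
          z = DirectSum.lof k ℕ (fun p => Hn k A N p) (n + 1) ((oneHat k A α) ⊗ₜ[k] Xm) -
              DirectSum.lof k ℕ (fun p => Hn k A N p) n (α ⊗ₜ[k] epsFirst k N n Xm)) ∨
       (∃ (n : ℕ) (α : OO k A n) (σ : Equiv.Perm (Fin n)) (i j : Fin n → Fin N),
          z = DirectSum.lof k ℕ (fun p => Hn k A N p) n ((lAct k A σ α) ⊗ₜ[k] Epure k N i j) -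
              DirectSum.lof k ℕ (fun p => Hn k A N p) n (α ⊗ₜ[k] Epure k N i (j ∘ σ))) ∨
       (∃ (n : ℕ) (α : OO k A n) (σ : Equiv.Perm (Fin n)) (i j : Fin n → Fin N),
          z = DirectSum.lof k ℕ (fun p => Hn k A N p) n ((rAct k A σ α) ⊗ₜ[k] Epure k N i j) -
              DirectSum.lof k ℕ (fun p => Hn k A N p) n (α ⊗ₜ[k] Epure k N (i ∘ ⇑σ⁻¹) j))}

/-- The subspace `I_N ⊆ O(A) ⊙ T(Mat_N^*(k))` spanned by the defining relations. -/
def IN : Submodule k (HH k A N) := Submodule.span k (ISet k A N)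

end

noncomputable section
set_option maxHeartbeats 1000000
set_option synthInstance.maxHeartbeats 400000
namespace HadIdeal
open TensorProduct PiTensorProduct

variable (k : Type*) [Field k]
variable (A : Type*) [Ring A] [Algebra k A]
variable (N : ℕ)

theorem splitFirst_tprod (M : Type*) [AddCommGroup M] [Module k M] (n : ℕ) (a : Fin (n+1) → M) :
    splitFirst k M n (tprod k a) = a 0 ⊗ₜ[k] tprod k (Fin.tail a) := by
  unfold splitFirst
  simp only [LinearEquiv.trans_apply]
  erw [reindex_tprod, tmulEquiv_symm_apply]
  rw [TensorProduct.congr_tmul, subsingletonEquiv_apply_tprod]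
  refine congrArg₂ _ ?_ ?_
  · rfl
  · refine congrArg (PiTensorProduct.tprod k) ?_
    funext i
    simp only [Fin.tail]
    refine congrArg a ?_
    ext
    simp [add_comm]

theorem splitFirst_symm_tmul (M : Type*) [AddCommGroup M] [Module k M] (n : ℕ) (x : M)
    (b : Fin n → M) :
    (splitFirst k M n).symm (x ⊗ₜ[k] tprod k b) =
      tprod k (Fin.cons x b : Fin (n+1) → M) := by
  rw [LinearEquiv.symm_apply_eq, splitFirst_tprod]
  simp

theorem mulInto_tmul {n : ℕ} (s : Fin n) (x : A) (b : Fin n → A) :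
    mulInto k A s (x ⊗ₜ[k] tprod k b) = tprod k (Function.update b s (x * b s)) := by
  cases n with
  | zero => exact s.elim0
  | succ m =>
    simp only [mulInto, LinearMap.comp_apply, LinearMap.lTensor_tmul, LinearEquiv.coe_coe,
      LinearEquiv.trans_apply]
    erw [reindex_tprod, splitFirst_tprod, TensorProduct.assoc_symm_tmul,
      LinearMap.rTensor_tmul, splitFirst_symm_tmul, reindex_tprod]
    congr 1
    ext i
    refine Fin.succAboveCases s ?_ (fun j => ?_) i
    · have h : (Equiv.symm s.cycleRange⁻¹) s = 0 := Fin.cycleRange_self s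
      rw [h]; simp
    · have h : (Equiv.symm s.cycleRange⁻¹) (s.succAbove j) = j.succ :=
        Fin.cycleRange_succAbove s j
      rw [h]; simp [Fin.tail]

theorem build_el {n : ℕ} {M : Type*} [AddCommMonoid M] [Module k M]
    (F : Equiv.Perm (Fin n) → ((TP k A n ⊗[k] SymA k A) →ₗ[k] M))
    (a : Fin n → A) (f : SymA k A) (u : Equiv.Perm (Fin n)) :
    build k A F (el k A a f u) = F u (tprod k a ⊗ₜ[k] f) := by
  simp [build, el]

theorem piMap_el_one {n : ℕ} (a : Fin (n+1) → A) (f : SymA k A) (u : Equiv.Perm (Fin (n+1)))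
    (h : u 0 = 0) : piMap k A (el k A a f u) =
      el k A (Fin.tail a) (iotaSym k A (qNat k A (a 0)) * f) (projSucc u) := by
  rw [piMap, build_el]
  simp [h, piCaseOne, withPerm, splitFirst_tprod, mulSym, el]

theorem piMap_el_two {n : ℕ} (a : Fin (n+1) → A) (f : SymA k A) (u : Equiv.Perm (Fin (n+1)))
    (h : u 0 ≠ 0) : piMap k A (el k A a f u) =
      el k A (Function.update (Fin.tail a) ((u 0).pred h) (a 0 * a (u 0))) f (projSucc u) := by
  rw [piMap, build_el]
  simp [h, piCaseTwo, withPerm, splitFirst_tprod, el, mulInto_tmul, Fin.tail]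

theorem oneHat_el {n : ℕ} (a : Fin n → A) (f : SymA k A) (u : Equiv.Perm (Fin n)) :
    oneHat k A (el k A a f u) =
      el k A (Fin.cons 1 a : Fin (n+1) → A) f (embedSucc u) := by
  rw [oneHat, build_el]
  simp [withPerm, consOne, splitFirst_symm_tmul, el]

theorem lAct_el {n : ℕ} (σ : Equiv.Perm (Fin n)) (a : Fin n → A) (f : SymA k A)
    (u : Equiv.Perm (Fin n)) :
    lAct k A σ (el k A a f u) = el k A (a ∘ ⇑σ.symm) f (σ * u) := by
  rw [lAct, build_el]
  simp only [withPerm, el, LinearMap.comp_apply, LinearMap.rTensor_tmul,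
    LinearEquiv.coe_coe]
  erw [reindex_tprod]
  rfl

theorem rAct_el {n : ℕ} (σ : Equiv.Perm (Fin n)) (a : Fin n → A) (f : SymA k A)
    (u : Equiv.Perm (Fin n)) :
    rAct k A σ (el k A a f u) = el k A a f (u * σ) := by
  simp [rAct, el]

theorem catPow_tmul (M : Type*) [AddCommGroup M] [Module k M] (n m : ℕ) (a : Fin n → M)
    (b : Fin m → M) :
    catPow k M n m (tprod k a ⊗ₜ[k] tprod k b) = tprod k (Fin.append a b) := by
  unfold catPow
  simp only [LinearEquiv.trans_apply]
  erw [tmulEquiv_apply, reindex_tprod]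
  congr 1
  ext i
  refine Fin.addCases (fun i => ?_) (fun i => ?_) i <;> simp

theorem mulOO_el {n m : ℕ} (a : Fin n → A) (f : SymA k A) (u : Equiv.Perm (Fin n))
    (b : Fin m → A) (g : SymA k A) (v : Equiv.Perm (Fin m)) :
    mulOO k A n m (el k A a f u ⊗ₜ[k] el k A b g v) =
      el k A (Fin.append a b) (f * g) (juxt2 u v) := by
  simp [mulOO, el, catPow_tmul, grpMul]

/-- pure elements of the Hadamard product -/
def Q {n : ℕ} (a : Fin n → A) (f : SymA k A) (u : Equiv.Perm (Fin n)) (X : Fin n → MatD k N) :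
    HH k A N :=
  DirectSum.lof k ℕ (fun p => Hn k A N p) n (el k A a f u ⊗ₜ[k] tprod k X)

theorem mulH_Q {n m : ℕ} (a : Fin n → A) (f : SymA k A) (u : Equiv.Perm (Fin n))
    (X : Fin n → MatD k N)
    (b : Fin m → A) (g : SymA k A) (v : Equiv.Perm (Fin m)) (Y : Fin m → MatD k N) :
    mulH k A N (Q k A N a f u X) (Q k A N b g v Y) =
      Q k A N (Fin.append a b) (f * g) (juxt2 u v) (Fin.append X Y) := by
  unfold Q mulH
  rw [DirectSum.toModule_lof, LinearMap.flip_apply, DirectSum.toModule_lof]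
  simp [mulHn, mulOO_el, catPow_tmul]

theorem SymA_comm (x y : SymA k A) : x * y = y * x := by
  obtain ⟨x, rfl⟩ := RingQuot.mkAlgHom_surjective k (symRel k A) x
  obtain ⟨y, rfl⟩ := RingQuot.mkAlgHom_surjective k (symRel k A) y
  rw [← map_mul, ← map_mul]
  exact RingQuot.mkAlgHom_rel k ⟨x, y, rfl, rfl⟩

theorem Q_cast {n m : ℕ} (h : n = m) (a : Fin m → A) (f : SymA k A) (u : Equiv.Perm (Fin m))
    (X : Fin m → MatD k N) :
    Q k A N a f u X = Q k A N (a ∘ Fin.cast h) f ((finCongr h.symm).permCongr u)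
      (X ∘ Fin.cast h) := by
  subst h
  rfl

theorem projSucc_succ {n : ℕ} (u : Equiv.Perm (Fin (n + 1))) (i : Fin n) :
    (projSucc u i).succ = if u i.succ = 0 then u 0 else u i.succ := by
  set e := ((finSuccEquiv n).symm.trans u).trans (finSuccEquiv n) with he
  have h0 : ∀ x : Fin n, x.succ = (finSuccEquiv n).symm (some x) := by simp
  have h1 : projSucc u i = Equiv.removeNone e i := rfl
  rw [h0, h1]
  split_ifs with h
  · rw [Equiv.removeNone_none e (by simp [he, h])]; simp [he]
  · have : ∃ x', e (some i) = some x' := by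
      obtain ⟨j, hj⟩ := Fin.exists_succ_eq.mpr h
      exact ⟨j, by simp [he, ← hj]⟩
    rw [Equiv.removeNone_some e this]; simp [he]

theorem embedSucc_zero {n : ℕ} (w : Equiv.Perm (Fin n)) : embedSucc w 0 = 0 := by
  simp [embedSucc]

theorem embedSucc_succ {n : ℕ} (w : Equiv.Perm (Fin n)) (i : Fin n) :
    embedSucc w i.succ = (w i).succ := by
  simp [embedSucc]

theorem juxt2_castAdd {n m : ℕ} (u : Equiv.Perm (Fin n)) (v : Equiv.Perm (Fin m)) (i : Fin n) :
    juxt2 u v (Fin.castAdd m i) = Fin.castAdd m (u i) := by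
  simp [juxt2]

theorem juxt2_natAdd {n m : ℕ} (u : Equiv.Perm (Fin n)) (v : Equiv.Perm (Fin m)) (i : Fin m) :
    juxt2 u v (Fin.natAdd n i) = Fin.natAdd n (v i) := by
  simp [juxt2]

end HadIdeal
end

noncomputable section
set_option maxHeartbeats 1000000
set_option synthInstance.maxHeartbeats 400000
namespace HadIdeal
open TensorProduct PiTensorProduct

variable (k : Type*) [Field k]
variable (A : Type*) [Ring A] [Algebra k A]
variable (N : ℕ)

theorem OO_ind {n : ℕ} {p : OO k A n → Prop} (hel : ∀ a f u, p (el k A a f u))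
    (hadd : ∀ x y, p x → p y → p (x + y)) (α : OO k A n) : p α := by
  have h0 : p 0 := by
    have := hel 0 0 1
    simpa [el] using this
  induction α using TensorProduct.induction_on with
  | zero => exact h0
  | add x y hx hy => exact hadd _ _ hx hy
  | tmul x w =>
    induction w using Finsupp.induction_linear with
    | zero => simpa using h0
    | add w w' h h' => rw [tmul_add]; exact hadd _ _ h h'
    | single u c =>
      induction x using TensorProduct.induction_on with
      | zero => simpa using h0
      | add x y hx hy => rw [add_tmul]; exact hadd _ _ hx hy
      | tmul t f =>
        induction t using PiTensorProduct.induction_on with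
        | add x y hx hy => rw [add_tmul, add_tmul]; exact hadd _ _ hx hy
        | smul_tprod r a =>
          have := hel a ((c * r) • f) u
          convert this using 1
          rw [el, show (Finsupp.single u c : GrpAlg k n) = c • Finsupp.single u 1 by simp,
            tmul_smul, smul_tmul', smul_tmul', smul_smul, smul_tmul]

theorem Estar_eq (p q : Fin N) :
    Estar k N p q = (Matrix.stdBasis k (Fin N) (Fin N)).dualBasis (p, q) := by
  apply (Matrix.stdBasis k (Fin N) (Fin N)).ext
  rintro ⟨r, s⟩
  rw [Module.Basis.dualBasis_apply_self, Matrix.stdBasis_eq_single]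
  change Matrix.single r s (1 : k) p q = _
  simp [Matrix.single_apply, eq_comm]

theorem Epure_span (n : ℕ) :
    Submodule.span k (Set.range fun ij : (Fin n → Fin N) × (Fin n → Fin N) =>
      Epure k N ij.1 ij.2) = ⊤ := by
  set S := Submodule.span k (Set.range fun ij : (Fin n → Fin N) × (Fin n → Fin N) =>
      Epure k N ij.1 ij.2) with hS
  rw [eq_top_iff, ← span_tprod_eq_top, Submodule.span_le]
  rintro _ ⟨X, rfl⟩
  letI : AddCommGroup (TM k N n) := Module.addCommMonoidToAddCommGroup k
  let q : TM k N n →ₗ[k] (TM k N n ⧸ S) := S.mkQ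
  have : q.compMultilinearMap
      (PiTensorProduct.tprod k : MultilinearMap k (fun _ : Fin n => MatD k N) (TM k N n)) = 0 := by
    refine Module.Basis.ext_multilinear
      (fun _ => (Matrix.stdBasis k (Fin N) (Fin N)).dualBasis) (fun v => ?_)
    simp only [LinearMap.compMultilinearMap_apply, MultilinearMap.zero_apply,
      Submodule.mkQ_apply, q, Submodule.Quotient.mk_eq_zero]
    refine Submodule.subset_span ⟨(fun t => (v t).1, fun t => (v t).2), ?_⟩
    simp [Epure, Estar_eq]
  have := congrArg (fun F => F X) this
  simpa [q] using this

theorem TM_ind {n : ℕ} {p : TM k N n → Prop} (h0 : p 0) (hE : ∀ i j, p (Epure k N i j))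
    (hadd : ∀ x y, p x → p y → p (x + y)) (hsmul : ∀ (c : k) x, p x → p (c • x))
    (X : TM k N n) : p X := by
  have hX : X ∈ Submodule.span k (Set.range fun ij : (Fin n → Fin N) × (Fin n → Fin N) =>
      Epure k N ij.1 ij.2) := by rw [Epure_span]; trivial
  induction hX using Submodule.span_induction with
  | mem x h => obtain ⟨ij, rfl⟩ := h; exact hE _ _
  | zero => exact h0
  | add x y _ _ hx hy => exact hadd _ _ hx hy
  | smul c x _ h => exact hsmul _ _ h


theorem HH_ind (S : Submodule k (HH k A N))
    (h : ∀ (n : ℕ) (a : Fin n → A) f u (i j : Fin n → Fin N),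
      Q k A N a f u (fun t => Estar k N (i t) (j t)) ∈ S) (x : HH k A N) : x ∈ S := by
  induction x using DirectSum.induction_on with
  | zero => exact S.zero_mem
  | add x y hx hy => exact S.add_mem hx hy
  | of n x =>
    change DirectSum.lof k ℕ (fun p => Hn k A N p) n x ∈ S
    induction x using TensorProduct.induction_on with
    | zero => rw [map_zero]; exact S.zero_mem
    | add x y hx hy => rw [map_add]; exact S.add_mem hx hy
    | tmul α X =>
      induction α using OO_ind with
      | hadd x y hx hy => rw [add_tmul, map_add]; exact S.add_mem hx hy
      | hel a f u =>
        induction X using TM_ind with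
        | h0 => rw [tmul_zero, map_zero]; exact S.zero_mem
        | hadd x y hx hy => rw [tmul_add, map_add]; exact S.add_mem hx hy
        | hsmul c x hx => rw [tmul_smul, map_smul]; exact S.smul_mem _ hx
        | hE i j => exact h n a f u i j

theorem consTr_tprod {n : ℕ} (X : Fin n → MatD k N) :
    consTr k N n (tprod k X) = tprod k (Fin.cons (trDual k N) X : Fin (n+1) → MatD k N) := by
  rw [consTr, splitFirst_symm_tmul]

theorem consTr_add {n : ℕ} (X Y : TM k N n) :
    consTr k N n (X + Y) = consTr k N n X + consTr k N n Y := by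
  simp [consTr, tmul_add]

theorem consTr_smul {n : ℕ} (c : k) (X : TM k N n) :
    consTr k N n (c • X) = c • consTr k N n X := by
  simp [consTr]

theorem consTr_zero {n : ℕ} : consTr k N n 0 = 0 := by
  simp [consTr]

theorem epsFirst_tprod {n : ℕ} (X : Fin (n+1) → MatD k N) :
    epsFirst k N n (tprod k X) = evalOne k N (X 0) • tprod k (Fin.tail X) := by
  simp [epsFirst, splitFirst_tprod]

theorem IN_le (S : Submodule k (HH k A N))
    (h1 : ∀ (n : ℕ) (a : Fin (n+1) → A) f (u : Equiv.Perm (Fin (n+1))) (X : Fin n → MatD k N),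
      u 0 = 0 →
      Q k A N (Fin.tail a) (iotaSym k A (qNat k A (a 0)) * f) (projSucc u) X -
        Q k A N a f u (Fin.cons (trDual k N) X : Fin (n+1) → MatD k N) ∈ S)
    (h2 : ∀ (n : ℕ) (a : Fin (n+1) → A) f (u : Equiv.Perm (Fin (n+1))) (X : Fin n → MatD k N)
      (h : u 0 ≠ 0),
      Q k A N (Function.update (Fin.tail a) ((u 0).pred h) (a 0 * a (u 0))) f (projSucc u) X -
        Q k A N a f u (Fin.cons (trDual k N) X : Fin (n+1) → MatD k N) ∈ S)
    (h3 : ∀ (n : ℕ) (a : Fin n → A) f (u : Equiv.Perm (Fin n)) (X : Fin (n+1) → MatD k N),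
      Q k A N (Fin.cons 1 a : Fin (n+1) → A) f (embedSucc u) X -
        evalOne k N (X 0) • Q k A N a f u (Fin.tail X) ∈ S)
    (h4 : ∀ (n : ℕ) (a : Fin n → A) f (u σ : Equiv.Perm (Fin n)) (i j : Fin n → Fin N),
      Q k A N (a ∘ σ.symm) f (σ * u) (fun t => Estar k N (i t) (j t)) -
        Q k A N a f u (fun t => Estar k N (i t) (j (σ t))) ∈ S)
    (h5 : ∀ (n : ℕ) (a : Fin n → A) f (u σ : Equiv.Perm (Fin n)) (i j : Fin n → Fin N),
      Q k A N a f (u * σ) (fun t => Estar k N (i t) (j t)) -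
        Q k A N a f u (fun t => Estar k N (i (σ.symm t)) (j t)) ∈ S) :
    IN k A N ≤ S := by
  rw [IN, Submodule.span_le]
  rintro z (⟨n, α, X, rfl⟩ | ⟨n, α, X, rfl⟩ | ⟨n, α, σ, i, j, rfl⟩ | ⟨n, α, σ, i, j, rfl⟩) <;>
    rw [SetLike.mem_coe] <;>
    induction α using OO_ind with
      | hadd x y hx hy =>
        simp only [map_add, add_tmul, add_sub_add_comm]; exact S.add_mem hx hy
      | hel a f u => ?_
  · induction X using TM_ind with
    | h0 => simp only [consTr_zero, tmul_zero, map_zero, sub_zero]; exact S.zero_mem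
    | hadd x y hx hy =>
      simp only [consTr_add, tmul_add, map_add, add_sub_add_comm]; exact S.add_mem hx hy
    | hsmul c x hx =>
      simp only [consTr_smul, tmul_smul, map_smul, ← smul_sub]; exact S.smul_mem _ hx
    | hE i j =>
      rw [Epure, consTr_tprod]
      by_cases h : u 0 = 0
      · rw [piMap_el_one _ _ _ _ _ h]; exact h1 n a f u _ h
      · rw [piMap_el_two _ _ _ _ _ h]; exact h2 n a f u _ h
  · induction X using TM_ind with
    | h0 => simp only [tmul_zero, map_zero, sub_zero]; exact S.zero_mem
    | hadd x y hx hy =>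
      simp only [tmul_add, map_add, add_sub_add_comm]; exact S.add_mem hx hy
    | hsmul c x hx =>
      simp only [tmul_smul, map_smul, ← smul_sub]; exact S.smul_mem _ hx
    | hE i j =>
      rw [Epure, epsFirst_tprod, oneHat_el, tmul_smul, map_smul]
      exact h3 n a f u _
  · rw [lAct_el]; exact h4 n a f u σ i j
  · rw [rAct_el]; exact h5 n a f u σ i j

theorem rel1 (n : ℕ) (a : Fin (n+1) → A) (f) (u : Equiv.Perm (Fin (n+1))) (X : Fin n → MatD k N)
    (h : u 0 = 0) :
    Q k A N (Fin.tail a) (iotaSym k A (qNat k A (a 0)) * f) (projSucc u) X -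
      Q k A N a f u (Fin.cons (trDual k N) X : Fin (n+1) → MatD k N) ∈ IN k A N := by
  refine Submodule.subset_span (Or.inl ⟨n, el k A a f u, tprod k X, ?_⟩)
  rw [piMap_el_one _ _ _ _ _ h, consTr_tprod]; rfl

theorem rel2 (n : ℕ) (a : Fin (n+1) → A) (f) (u : Equiv.Perm (Fin (n+1))) (X : Fin n → MatD k N)
    (h : u 0 ≠ 0) :
    Q k A N (Function.update (Fin.tail a) ((u 0).pred h) (a 0 * a (u 0))) f (projSucc u) X -
      Q k A N a f u (Fin.cons (trDual k N) X : Fin (n+1) → MatD k N) ∈ IN k A N := by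
  refine Submodule.subset_span (Or.inl ⟨n, el k A a f u, tprod k X, ?_⟩)
  rw [piMap_el_two _ _ _ _ _ h, consTr_tprod]; rfl

theorem rel3 (n : ℕ) (a : Fin n → A) (f) (u : Equiv.Perm (Fin n)) (X : Fin (n+1) → MatD k N) :
    Q k A N (Fin.cons 1 a : Fin (n+1) → A) f (embedSucc u) X -
      evalOne k N (X 0) • Q k A N a f u (Fin.tail X) ∈ IN k A N := by
  refine Submodule.subset_span (Or.inr (Or.inl ⟨n, el k A a f u, tprod k X, ?_⟩))
  rw [oneHat_el, epsFirst_tprod, tmul_smul, map_smul]; rfl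

theorem rel4 (n : ℕ) (a : Fin n → A) (f) (u σ : Equiv.Perm (Fin n)) (i j : Fin n → Fin N) :
    Q k A N (a ∘ σ.symm) f (σ * u) (fun t => Estar k N (i t) (j t)) -
      Q k A N a f u (fun t => Estar k N (i t) (j (σ t))) ∈ IN k A N := by
  refine Submodule.subset_span (Or.inr (Or.inr (Or.inl ⟨n, el k A a f u, σ, i, j, ?_⟩)))
  rw [lAct_el]; rfl

theorem rel5 (n : ℕ) (a : Fin n → A) (f) (u σ : Equiv.Perm (Fin n)) (i j : Fin n → Fin N) :
    Q k A N a f (u * σ) (fun t => Estar k N (i t) (j t)) -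
      Q k A N a f u (fun t => Estar k N (i (σ.symm t)) (j t)) ∈ IN k A N := by
  refine Submodule.subset_span (Or.inr (Or.inr (Or.inr ⟨n, el k A a f u, σ, i, j, ?_⟩)))
  rw [rAct_el]; rfl

theorem rel_conj {p q : ℕ} (e : Fin p ≃ Fin q) (a : Fin p → A) (f) (u : Equiv.Perm (Fin p))
    (i j : Fin p → Fin N) :
    Q k A N (a ∘ e.symm) f (e.permCongr u)
        (fun t => Estar k N (i (e.symm t)) (j (e.symm t))) -
      Q k A N a f u (fun t => Estar k N (i t) (j t)) ∈ IN k A N := by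
  obtain rfl : p = q := by simpa using Fintype.card_congr e
  have h4 := rel4 k A N p a f (u * e.symm) e (i ∘ e.symm) (j ∘ e.symm)
  have h5 := rel5 k A N p a f u e.symm (i ∘ e.symm) j
  have := (IN k A N).add_mem h4 h5
  simp only [Function.comp_apply, Equiv.symm_apply_apply, Equiv.symm_symm] at this
  rw [sub_add_sub_cancel] at this
  exact this

theorem append_Estar {n m : ℕ} (i j : Fin n → Fin N) (i' j' : Fin m → Fin N) :
    Fin.append (fun t => Estar k N (i t) (j t)) (fun t => Estar k N (i' t) (j' t)) =
      fun t => Estar k N (Fin.append i i' t) (Fin.append j j' t) := by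
  funext t
  refine Fin.addCases (fun t => ?_) (fun t => ?_) t <;> simp

theorem comm_mem (x y : HH k A N) : mulH k A N y x - mulH k A N x y ∈ IN k A N := by
  refine HH_ind k A N ((IN k A N).comap ((mulH k A N).flip x - mulH k A N x)) ?_ y
  intro m b g v i' j'
  rw [Submodule.mem_comap, LinearMap.sub_apply, LinearMap.flip_apply]
  refine HH_ind k A N ((IN k A N).comap (mulH k A N (Q k A N b g v
    (fun t => Estar k N (i' t) (j' t))) - (mulH k A N).flip (Q k A N b g v
    (fun t => Estar k N (i' t) (j' t))))) ?_ x
  intro n a f u i j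
  rw [Submodule.mem_comap, LinearMap.sub_apply, LinearMap.flip_apply]
  rw [mulH_Q, mulH_Q, append_Estar, append_Estar]
  have := rel_conj k A N (finAddFlip : Fin (n + m) ≃ Fin (m + n)) (Fin.append a b) (f * g)
    (juxt2 u v) (Fin.append i i') (Fin.append j j')
  convert this using 2
  have hs : ∀ (t : Fin (m + n)), (finAddFlip : Fin (n + m) ≃ Fin (m + n)).symm t =
      finAddFlip t := fun t => by
    rw [Equiv.symm_apply_eq]
    refine Fin.addCases (fun t => ?_) (fun t => ?_) t <;> simp
  congr 1
  · funext t
    simp only [Function.comp_apply, hs]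
    refine Fin.addCases (fun t => ?_) (fun t => ?_) t <;> simp
  · exact SymA_comm _ _ _ _
  · ext t
    rw [Equiv.permCongr_apply, hs]
    refine Fin.addCases (fun t => ?_) (fun t => ?_) t <;> simp [juxt2_castAdd, juxt2_natAdd]
  · funext t
    simp only [hs]
    refine Fin.addCases (fun t => ?_) (fun t => ?_) t <;> simp

end HadIdeal
end

noncomputable section
set_option maxHeartbeats 1000000
set_option synthInstance.maxHeartbeats 400000
namespace HadIdeal
open TensorProduct PiTensorProduct

variable (k : Type*) [Field k]
variable (A : Type*) [Ring A] [Algebra k A]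
variable (N : ℕ)

theorem arith {n m : ℕ} : n + m + 1 = n + 1 + m := by omega

theorem cast_cases {n m : ℕ} {P : Fin (n + m + 1) → Prop} (h0 : P 0)
    (h1 : ∀ i : Fin n, P (Fin.castAdd m i).succ) (h2 : ∀ i : Fin m, P (Fin.natAdd n i).succ)
    (i) : P i :=
  Fin.cases h0 (fun i => Fin.addCases h1 h2 i) i

theorem cast_zero {n m : ℕ} :
    Fin.cast (arith (n := n) (m := m)) 0 = Fin.castAdd m 0 := rfl

theorem cast_left {n m : ℕ} (i : Fin n) :
    Fin.cast arith (Fin.castAdd m i).succ = Fin.castAdd m i.succ := rfl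

theorem cast_right {n m : ℕ} (i : Fin m) :
    Fin.cast arith (Fin.natAdd n i).succ = Fin.natAdd (n+1) i := by
  ext; simp; omega

theorem append_cast_zero {M : Type*} {n m : ℕ} (a : Fin (n+1) → M) (b : Fin m → M) :
    (Fin.append a b ∘ Fin.cast arith) 0 = a 0 := by
  rw [Function.comp_apply, cast_zero, Fin.append_left]

theorem append_cast_tail {M : Type*} {n m : ℕ} (a : Fin (n+1) → M) (b : Fin m → M) :
    Fin.tail (Fin.append a b ∘ Fin.cast arith) = Fin.append (Fin.tail a) b := by
  funext t
  rw [Fin.tail, Function.comp_apply]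
  refine Fin.addCases (fun t => ?_) (fun t => ?_) t
  · rw [cast_left]; simp [Fin.tail]
  · rw [cast_right]; simp

theorem append_cast_cons {M : Type*} {n m : ℕ} (x : M) (a : Fin n → M) (b : Fin m → M) :
    Fin.append (Fin.cons x a : Fin (n+1) → M) b ∘ Fin.cast arith =
      (Fin.cons x (Fin.append a b) : Fin (n+m+1) → M) := by
  rw [← Fin.cons_self_tail (Fin.append (Fin.cons x a : Fin (n+1) → M) b ∘ Fin.cast arith),
    append_cast_zero, append_cast_tail, Fin.cons_zero, Fin.tail_cons]

/-- The permutation `u × v` seen in `S(n+m+1)`. -/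
def jc {n m : ℕ} (u : Equiv.Perm (Fin (n+1))) (v : Equiv.Perm (Fin m)) :
    Equiv.Perm (Fin (n + m + 1)) :=
  (finCongr (arith (n := n) (m := m)).symm).permCongr (juxt2 u v)

/-- The inclusion of the first `n+1` indices. -/
def inc {n m : ℕ} (i : Fin (n+1)) : Fin (n + m + 1) := Fin.cast arith.symm (Fin.castAdd m i)

theorem inc_inj {n m : ℕ} {i j : Fin (n+1)} : (inc (m := m) i = inc j) ↔ i = j := by
  simp [inc, Fin.ext_iff]

theorem inc_zero {n m : ℕ} : inc (n := n) (m := m) 0 = 0 := rfl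

theorem inc_succ {n m : ℕ} (i : Fin n) : inc (m := m) i.succ = (Fin.castAdd m i).succ := rfl

theorem append_inc {M : Type*} {n m : ℕ} (a : Fin (n+1) → M) (b : Fin m → M) (i) :
    (Fin.append a b ∘ Fin.cast arith) (inc i) = a i := by
  simp [inc]

theorem jc_inc {n m : ℕ} (u : Equiv.Perm (Fin (n+1))) (v : Equiv.Perm (Fin m)) (i) :
    jc u v (inc i) = inc (u i) := by
  simp [jc, inc, juxt2_castAdd]

theorem jc_zero {n m : ℕ} (u : Equiv.Perm (Fin (n+1))) (v : Equiv.Perm (Fin m)) :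
    jc u v 0 = inc (u 0) := by
  rw [← inc_zero, jc_inc]

theorem jc_right {n m : ℕ} (u : Equiv.Perm (Fin (n+1))) (v : Equiv.Perm (Fin m)) (i : Fin m) :
    jc u v (Fin.natAdd n i).succ = (Fin.natAdd n (v i)).succ := by
  have h : (Fin.natAdd n i).succ = Fin.cast arith.symm (Fin.natAdd (n+1) i) := by
    rw [← cast_right]; rfl
  rw [h]
  simp only [jc, Equiv.permCongr_apply, finCongr_symm, finCongr_apply, Fin.cast_cast, Fin.cast_eq_self,
    juxt2_natAdd]
  rw [← cast_right]; rfl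

theorem projSucc_jc {n m : ℕ} (u : Equiv.Perm (Fin (n+1))) (v : Equiv.Perm (Fin m)) :
    projSucc (jc u v) = juxt2 (projSucc u) v := by
  refine Equiv.ext fun t => ?_
  apply Fin.succ_injective
  rw [projSucc_succ, jc_zero]
  refine Fin.addCases (fun t => ?_) (fun t => ?_) t
  · rw [← inc_succ, jc_inc, juxt2_castAdd, ← inc_succ, projSucc_succ, ← inc_zero]
    simp only [inc_inj]
    split_ifs <;> rfl
  · rw [jc_right, juxt2_natAdd, if_neg (Fin.succ_ne_zero _)]

theorem embedSucc_jc {n m : ℕ} (u : Equiv.Perm (Fin n)) (v : Equiv.Perm (Fin m)) :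
    jc (embedSucc u) v = embedSucc (juxt2 u v) := by
  refine Equiv.ext fun t => ?_
  refine cast_cases (P := fun t => jc (embedSucc u) v t = embedSucc (juxt2 u v) t) ?_ (fun t => ?_) (fun t => ?_) t
  · rw [jc_zero, embedSucc_zero, embedSucc_zero]; rfl
  · rw [← inc_succ, jc_inc, embedSucc_succ, inc_succ, inc_succ, embedSucc_succ, juxt2_castAdd]
  · rw [jc_right, embedSucc_succ, juxt2_natAdd]

theorem juxt2_mul {n m : ℕ} (u s : Equiv.Perm (Fin n)) (v w : Equiv.Perm (Fin m)) :
    juxt2 (s * u) (w * v) = juxt2 s w * juxt2 u v := by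
  refine Equiv.ext fun t => ?_
  refine Fin.addCases (fun t => ?_) (fun t => ?_) t <;>
    simp [juxt2_castAdd, juxt2_natAdd]

theorem juxt2_symm {n m : ℕ} (u : Equiv.Perm (Fin n)) (v : Equiv.Perm (Fin m)) :
    (juxt2 u v).symm = juxt2 u.symm v.symm := by
  refine Equiv.ext fun t => ?_
  rw [Equiv.symm_apply_eq]
  refine Fin.addCases (fun t => ?_) (fun t => ?_) t <;>
    simp [juxt2_castAdd, juxt2_natAdd]

theorem append_juxt2 {M : Type*} {n m : ℕ} (a : Fin n → M) (b : Fin m → M)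
    (u : Equiv.Perm (Fin n)) :
    Fin.append (a ∘ u) b = Fin.append a b ∘ juxt2 u 1 := by
  funext t
  refine Fin.addCases (fun t => ?_) (fun t => ?_) t <;>
    simp [juxt2_castAdd, juxt2_natAdd]

theorem update_append {M : Type*} {n m : ℕ} (a : Fin n → M) (b : Fin m → M) (s : Fin n) (x : M) :
    Fin.append (Function.update a s x) b =
      Function.update (Fin.append a b) (Fin.castAdd m s) x := by
  funext t
  refine Fin.addCases (fun t => ?_) (fun t => ?_) t
  · simp [Function.update_apply]
  · rw [Function.update_of_ne (by simp [Fin.ext_iff]; omega)]; simp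

theorem mul_right_mem (y : HH k A N) (x : HH k A N) (hx : x ∈ IN k A N) :
    mulH k A N x y ∈ IN k A N := by
  refine HH_ind k A N ((IN k A N).comap (mulH k A N x)) ?_ y
  intro m b g v i' j'
  rw [Submodule.mem_comap]
  set Y : Fin m → MatD k N := fun t => Estar k N (i' t) (j' t) with hY
  refine IN_le k A N ((IN k A N).comap ((mulH k A N).flip (Q k A N b g v Y))) ?_ ?_ ?_ ?_ ?_ hx
  · intro n a f u X h
    rw [Submodule.mem_comap, map_sub, LinearMap.flip_apply, LinearMap.flip_apply, mulH_Q, mulH_Q,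
      Q_cast k A N arith (Fin.append a b), append_cast_cons]
    have := rel1 k A N (n + m) (Fin.append a b ∘ Fin.cast arith) (f * g) (jc u v)
      (Fin.append X Y) (by rw [jc_zero, h]; rfl)
    rw [projSucc_jc, append_cast_tail, append_cast_zero, ← mul_assoc] at this
    exact this
  · intro n a f u X h
    rw [Submodule.mem_comap, map_sub, LinearMap.flip_apply, LinearMap.flip_apply, mulH_Q, mulH_Q,
      Q_cast k A N arith (Fin.append a b), append_cast_cons]
    have h' : jc u v 0 ≠ 0 := by rw [jc_zero, ← inc_zero, Ne, inc_inj]; exact h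
    have := rel2 k A N (n + m) (Fin.append a b ∘ Fin.cast arith) (f * g) (jc u v)
      (Fin.append X Y) h'
    have hp : (jc u v 0).pred h' = Fin.castAdd m ((u 0).pred h) := by
      apply Fin.succ_injective
      rw [Fin.succ_pred, ← inc_succ, Fin.succ_pred, jc_zero]
    rw [projSucc_jc, append_cast_tail, append_cast_zero, hp, jc_zero, append_inc,
      ← update_append] at this
    exact this
  · intro n a f u X
    rw [Submodule.mem_comap, map_sub, map_smul, LinearMap.flip_apply, LinearMap.flip_apply,
      mulH_Q, mulH_Q, Q_cast k A N arith _ _ (juxt2 (embedSucc u) v), append_cast_cons]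
    have := rel3 k A N (n + m) (Fin.append a b) (f * g) (juxt2 u v)
      (Fin.append X Y ∘ Fin.cast arith)
    rw [append_cast_zero, append_cast_tail, ← embedSucc_jc] at this
    exact this
  · intro n a f u σ i j
    rw [Submodule.mem_comap, map_sub, LinearMap.flip_apply, LinearMap.flip_apply, mulH_Q, mulH_Q,
      hY, append_Estar, append_Estar k N i (fun t => j (σ t))]
    have := rel4 k A N (n + m) (Fin.append a b) (f * g) (juxt2 u v) (juxt2 σ 1)
      (Fin.append i i') (Fin.append j j')
    rw [juxt2_symm, ← juxt2_mul, one_mul] at this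
    have e1 := append_juxt2 a b σ.symm
    have e2 := append_juxt2 j j' σ
    have e3 : (fun t => j (σ t)) = j ∘ σ := rfl
    rw [e1, e3, e2]
    exact this
  · intro n a f u σ i j
    rw [Submodule.mem_comap, map_sub, LinearMap.flip_apply, LinearMap.flip_apply, mulH_Q, mulH_Q,
      hY, append_Estar, append_Estar k N (fun t => i (σ.symm t)) j]
    have := rel5 k A N (n + m) (Fin.append a b) (f * g) (juxt2 u v) (juxt2 σ 1)
      (Fin.append i i') (Fin.append j j')
    rw [juxt2_symm, ← juxt2_mul, mul_one] at this
    have e2 := append_juxt2 i i' σ.symm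
    have e3 : (fun t => i (σ.symm t)) = i ∘ σ.symm := rfl
    rw [e3, e2]
    exact this

end HadIdeal
end

theorem IN_is_two_sided_ideal (k : Type*) [Field k] [IsAlgClosed k] [CharZero k]
    (A : Type*) [Ring A] [Algebra k A] (N : ℕ) (hN : 1 ≤ N) :
    ∀ y : HH k A N, ∀ x ∈ IN k A N,
      mulH k A N y x ∈ IN k A N ∧ mulH k A N x y ∈ IN k A N := by
  intro y x hx
  have h := HadIdeal.mul_right_mem k A N y x hx
  refine ⟨?_, h⟩
  have hc := HadIdeal.comm_mem k A N x y
  have := (IN k A N).add_mem hc h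
  rwa [sub_add_cancel] at this
end

section
/- Let A = k⟨x_1,…,x_d⟩ be the free associative algebra on d ≥ 1 generators over an algebraically closed field k of characteristic zero, and let n ≥ 0. If α ∈ O(A)^(n) satisfies α_{ij}(X) = 0 for every N ≥ 1, every pair of tuples i, j ∈ {1,…,N}^n, and every d-tuple of matrices X = (X_1,…,X_d) ∈ Mat_N(k)^d, then α = 0. -/
noncomputable section

set_option maxHeartbeats 1000000
set_option synthInstance.maxHeartbeats 400000

variable (k : Type*) [Field k]

variable (d : ℕ)

/-- The free associative algebra `A = k⟨x_1,…,x_d⟩`. -/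
abbrev FreeA := FreeAlgebra k (Fin d)

variable (N : ℕ) (X : Fin d → Matrix (Fin N) (Fin N) k)

/-- Evaluation of the free algebra at a `d`-tuple of `N×N` matrices. -/
def rhoX : FreeA k d →ₐ[k] Matrix (Fin N) (Fin N) k := FreeAlgebra.lift k X

/-- `a ↦ tr(ρ_X(a))`. -/
def trAX : FreeA k d →ₗ[k] k :=
  Matrix.traceLinearMap (Fin N) k k ∘ₗ (rhoX k d N X).toLinearMap

/-- The trace of the evaluation descends to `A_♮`. -/
def trNatX : Anat k (FreeA k d) →ₗ[k] k :=
  Submodule.liftQ (commSM k (FreeA k d)) (trAX k d N X) (Submodule.span_le.mpr (by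
    rintro x ⟨a, b, rfl⟩
    simp only [SetLike.mem_coe, LinearMap.mem_ker, map_sub]
    have : trAX k d N X (a * b) = trAX k d N X (b * a) := by
      show Matrix.trace ((rhoX k d N X) (a * b)) = Matrix.trace ((rhoX k d N X) (b * a))
      rw [map_mul, map_mul]
      exact Matrix.trace_mul_comm _ _
    rw [this, sub_self]))

/-- The multiplicative extension `Sym(A_♮) → k` of the trace of the evaluation. -/
def trSymX : SymA k (FreeA k d) →ₐ[k] k :=
  RingQuot.liftAlgHom k ⟨TensorAlgebra.lift k (trNatX k d N X), by
    rintro x y ⟨u, v, rfl, rfl⟩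
    simp only [map_mul]
    exact mul_comm _ _⟩

/-- The `(s,t)`-matrix-entry functional. -/
def entryK (s t : Fin N) : Matrix (Fin N) (Fin N) k →ₗ[k] k where
  toFun M := M s t
  map_add' _ _ := rfl
  map_smul' _ _ := rfl

/-- The evaluation `α ↦ α_{ij}(X) ∈ k` on `O(A)^{(n)}`:
`((a_1⊗…⊗a_n)⊗(f_1⋯f_m)⊗u)_{ij}(X) = ∏_t (ρ_X(a_t))_{i_{u⁻¹(t)} j_t} ∏_s tr(ρ_X(f_s))`. -/
def pairKval {n : ℕ} (i j : Fin n → Fin N) : OO k (FreeA k d) n →ₗ[k] k :=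
  build k (FreeA k d) (fun u =>
    TensorProduct.lift
      ((LinearMap.mul k k).compl₁₂
        (PiTensorProduct.lift
          ((MultilinearMap.mkPiAlgebra k (Fin n) k).compLinearMap
            (fun t => entryK k N (i (u⁻¹ t)) (j t) ∘ₗ (rhoX k d N X).toLinearMap)))
        (trSymX k d N X).toLinearMap))

section Helpers
open TensorProduct Module

/-- The monomial of a word. -/
def wd (k : Type*) [Field k] (d : ℕ) (w : List (Fin d)) : FreeA k d :=
  (w.map (FreeAlgebra.ι k)).prod

/-- The word basis, indexed by lists. -/
def wbasis (k : Type*) [Field k] (d : ℕ) : Basis (List (Fin d)) k (FreeA k d) :=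
  (FreeAlgebra.basisFreeMonoid k (Fin d)).reindex FreeMonoid.toList

theorem wbasis_apply (k : Type*) [Field k] (d : ℕ) (w : List (Fin d)) :
    wbasis k d w = wd k d w := by
  simp [wbasis, wd, FreeAlgebra.basisFreeMonoid, FreeAlgebra.equivMonoidAlgebraFreeMonoid, FreeMonoid.lift_apply]

/-- Evaluation at matrices over an arbitrary finite index type. -/
def rhoG (k : Type*) [Field k] (d : ℕ) {ι : Type*} [Fintype ι] [DecidableEq ι]
    (X : Fin d → Matrix ι ι k) : FreeA k d →ₐ[k] Matrix ι ι k := FreeAlgebra.lift k X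

section
variable {k : Type*} [Field k] {d : ℕ} {ι κ : Type*} [Fintype ι] [DecidableEq ι]
  [Fintype κ] [DecidableEq κ]

theorem wd_nil : wd k d [] = 1 := rfl
theorem wd_cons (p : Fin d) (w : List (Fin d)) :
    wd k d (p :: w) = FreeAlgebra.ι k p * wd k d w := by simp [wd]

theorem wd_append (v w : List (Fin d)) :
    wd k d (v ++ w) = wd k d v * wd k d w := by simp [wd]

theorem rhoG_nil (X : Fin d → Matrix ι ι k) : rhoG k d X (wd k d []) = 1 := by simp [wd]

theorem rhoG_cons (X : Fin d → Matrix ι ι k) (p : Fin d) (w : List (Fin d)) :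
    rhoG k d X (wd k d (p :: w)) = X p * rhoG k d X (wd k d w) := by
  simp [wd_cons, rhoG]

theorem rhoG_reindex (X : Fin d → Matrix ι ι k) (e : ι ≃ κ) (a : FreeA k d) :
    rhoG k d (fun p => (X p).reindex e e) a = (rhoG k d X a).reindex e e := by
  have : rhoG k d (fun p => (X p).reindex e e) =
      (Matrix.reindexAlgEquiv k k e).toAlgHom.comp (rhoG k d X) := by
    apply FreeAlgebra.hom_ext
    funext p
    simp [rhoG]
  rw [this]; rfl

theorem rhoG_sum (X : Fin d → Matrix ι ι k) (Y : Fin d → Matrix κ κ k) (a : FreeA k d) :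
    rhoG k d (fun p => Matrix.fromBlocks (X p) 0 0 (Y p)) a =
      Matrix.fromBlocks (rhoG k d X a) 0 0 (rhoG k d Y a) := by
  induction a using FreeAlgebra.induction with
  | grade0 r =>
    rw [AlgHom.commutes, AlgHom.commutes, AlgHom.commutes, Algebra.algebraMap_eq_smul_one,
      Algebra.algebraMap_eq_smul_one, Algebra.algebraMap_eq_smul_one, ← Matrix.fromBlocks_one,
      Matrix.fromBlocks_smul, smul_zero, smul_zero]
  | grade1 p => simp [rhoG]
  | mul a b ha hb => simp [ha, hb, Matrix.fromBlocks_multiply]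
  | add a b ha hb => simp [ha, hb, Matrix.fromBlocks_add]

theorem rhoG_smul (X : Fin d → Matrix ι ι k) (t : k) (w : List (Fin d)) :
    rhoG k d (fun p => t • X p) (wd k d w) = t ^ w.length • rhoG k d X (wd k d w) := by
  induction w with
  | nil => simp [rhoG_nil]
  | cons p w ih => rw [rhoG_cons, rhoG_cons, ih]; simp [pow_succ', smul_smul, mul_comm]
end

/-! ### Separation of `A_♮` by traces -/

section
variable (k : Type*) [Field k] {d : ℕ}

instance (w : List (Fin d)) : Finite {l : List (Fin d) // w ~r l} := by
  have : {l : List (Fin d) | w ~r l} ⊆ {l | l ∈ w.cyclicPermutations} := by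
    intro l hl
    exact List.mem_cyclicPermutations_iff.mpr hl.symm
  exact ((List.finite_toSet w.cyclicPermutations).subset this).to_subtype

open Classical in
/-- The cyclic representation attached to a word. -/
def cycX (w : List (Fin d)) (p : Fin d) :
    Matrix {l : List (Fin d) // w ~r l} {l : List (Fin d) // w ~r l} k :=
  fun l l' => if ∃ m, l.1 = p :: m ∧ l'.1 = m ++ [p] then 1 else 0

noncomputable instance (w : List (Fin d)) : Fintype {l : List (Fin d) // w ~r l} :=
  Fintype.ofFinite _

open Classical in
theorem cycX_word (w v : List (Fin d)) (hv : v.length ≤ w.length)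
    (l l' : {l : List (Fin d) // w ~r l}) :
    rhoG k d (cycX k w) (wd k d v) l l' =
      if ∃ m, l.1 = v ++ m ∧ l'.1 = m ++ v then 1 else 0 := by
  induction v generalizing l l' with
  | nil => 
    rw [rhoG_nil, Matrix.one_apply]
    simp [Subtype.ext_iff, eq_comm]
  | cons p v ih =>
    rw [rhoG_cons, Matrix.mul_apply]
    simp only [List.length_cons] at hv
    have ih' := ih (by omega)
    simp only [ih', cycX]
    by_cases h : ∃ m, l.1 = p :: m
    · obtain ⟨m, hm⟩ := h
      have hr : w ~r (m ++ [p]) := by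
        refine l.2.trans ?_
        rw [hm]
        exact ⟨1, by simp⟩
      rw [Finset.sum_eq_single ⟨m ++ [p], hr⟩]
      · simp only [hm]
        have hlen : m.length + 1 = w.length := by simpa using hr.perm.length_eq.symm
        simp only [List.cons.injEq, true_and, exists_eq_left', if_true, one_mul]
        congr 1
        apply propext
        constructor
        · rintro ⟨q, h1, h2⟩
          have : v <+: m := by
            refine List.prefix_of_prefix_length_le (⟨q, h1.symm⟩) (List.prefix_append m [p]) (by omega)
          obtain ⟨z, rfl⟩ := this
          refine ⟨z, rfl, ?_⟩
          rw [List.append_assoc, List.append_cancel_left_eq] at h1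
          subst h1
          simpa using h2
        · rintro ⟨z, h1, h2⟩
          have h1' : m = v ++ z := by simpa using h1
          subst h1'
          exact ⟨z ++ [p], by simp, by simpa using h2⟩
      · intro b _ hb
        rw [if_neg, zero_mul]
        rintro ⟨z, h1, h2⟩
        apply hb
        rw [hm] at h1
        apply Subtype.ext
        simp_all
      · simp
    · rw [if_neg, Finset.sum_eq_zero]
      · intro b _
        rw [if_neg, zero_mul]
        rintro ⟨m, h1, _⟩; exact h ⟨m, h1⟩
      · rintro ⟨m, h1, _⟩; exact h ⟨v ++ m, by simpa using h1⟩

open Classical in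
theorem cycX_trace (w v : List (Fin d)) (hv : v.length = w.length) :
    (rhoG k d (cycX k w) (wd k d v)).trace = if w ~r v then 1 else 0 := by
  have key : ∀ l : {l : List (Fin d) // w ~r l},
      rhoG k d (cycX k w) (wd k d v) l l = if l.1 = v then 1 else 0 := by
    intro l
    rw [cycX_word k w v hv.le]
    congr 1
    apply propext
    have hl := l.2.perm.length_eq
    constructor
    · rintro ⟨m, h1, _⟩
      have : m = [] := by
        have := congrArg List.length h1
        simp at this
        exact List.eq_nil_of_length_eq_zero (by omega)
      simpa [this] using h1
    · intro h; exact ⟨[], by simp [h], by simp [h]⟩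
  simp only [Matrix.trace, Matrix.diag, key]
  split_ifs with h
  · rw [Finset.sum_eq_single ⟨v, h⟩]
    · simp
    · intro b _ hb; rw [if_neg]; intro h'; exact hb (Subtype.ext h')
    · simp
  · apply Finset.sum_eq_zero
    intro b _
    rw [if_neg]; rintro rfl; exact h b.2

theorem wd_rot {v w : List (Fin d)} (h : v ~r w) :
    qNat k (FreeA k d) (wd k d v) = qNat k (FreeA k d) (wd k d w) := by
  obtain ⟨n, rfl⟩ := h
  induction n with
  | zero => simp
  | succ n ih =>
    rw [ih, ← List.rotate_rotate]
    cases h : v.rotate n with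
    | nil => simp
    | cons p m =>
      simp only [List.rotate_cons_succ, List.rotate_zero]
      rw [← sub_eq_zero, ← map_sub]
      unfold qNat
      rw [Submodule.mkQ_apply, Submodule.Quotient.mk_eq_zero]
      refine Submodule.subset_span ⟨FreeAlgebra.ι k p, wd k d m, ?_⟩
      simp [wd]

theorem trace_sep [Infinite k] (f : FreeA k d)
    (hf : ∀ (N : ℕ) (X : Fin d → Matrix (Fin N) (Fin N) k), trAX k d N X f = 0) :
    qNat k (FreeA k d) f = 0 := by
  classical
  -- general index types
  have hG : ∀ (w : List (Fin d)) (X : Fin d → Matrix {l : List (Fin d) // w ~r l} {l : List (Fin d) // w ~r l} k),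
      (rhoG k d X f).trace = 0 := by
    intro w X
    have h := hf _ (fun p => (X p).reindex (Fintype.equivFin _) (Fintype.equivFin _))
    change (rhoG k d (fun p => (X p).reindex (Fintype.equivFin _) (Fintype.equivFin _)) f).trace = 0 at h
    rw [rhoG_reindex] at h
    simpa [Matrix.trace, ← Equiv.sum_comp (Fintype.equivFin {l : List (Fin d) // w ~r l})] using h
  have hexp : f = ((wbasis k d).repr f).sum (fun w c => c • wd k d w) := by
    conv_lhs => rw [← (wbasis k d).linearCombination_repr f]
    simp [Finsupp.linearCombination_apply, wbasis_apply]
  set c := (wbasis k d).repr f with hc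
  let C : Cycle (Fin d) →₀ k := c.mapDomain (fun w : List (Fin d) => (w : Cycle (Fin d)))
  have hC : C = 0 := by
    ext γ
    induction γ using Quotient.inductionOn with
    | _ w =>
    let Q : Polynomial k := c.sum (fun v a => Polynomial.monomial v.length (a * (rhoG k d (cycX k w) (wd k d v)).trace))
    have hQ : Q = 0 := by
      apply Polynomial.funext
      intro t
      have := hG w (fun p => t • cycX k w p)
      rw [hexp] at this
      simp only [Finsupp.sum, map_sum, map_smul, rhoG_smul, Matrix.trace_sum, Matrix.trace_smul] at this
      simp only [Q, Finsupp.sum, Polynomial.eval_finsetSum, Polynomial.eval_monomial, Polynomial.eval_zero]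
      rw [← this]
      refine Finset.sum_congr rfl fun v _ => ?_
      simp only [smul_eq_mul]; ring
    have h2 := congrArg (fun q => Polynomial.coeff q w.length) hQ
    simp only [Q, Finsupp.sum, Polynomial.finsetSum_coeff, Polynomial.coeff_monomial, Polynomial.coeff_zero] at h2
    change C (w : Cycle (Fin d)) = 0
    simp only [C, Finsupp.mapDomain, Finsupp.sum, Finsupp.finsetSum_apply, Finsupp.single_apply]
    refine Eq.trans (Finset.sum_congr rfl fun v _ => ?_) h2
    by_cases hl : v.length = w.length
    · rw [if_pos hl, cycX_trace k w v hl]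
      by_cases hr : w ~r v
      · rw [if_pos hr, if_pos, mul_one]
        exact Quotient.sound hr.symm
      · rw [if_neg hr, if_neg, mul_zero]
        intro h; exact hr (Quotient.exact h).symm
    · rw [if_neg hl, if_neg]
      intro h; exact hl ((Quotient.exact h : v ~r w).perm.length_eq)
  let g : Cycle (Fin d) → Anat k (FreeA k d) := Quotient.lift (fun w => qNat k (FreeA k d) (wd k d w)) (fun _ _ h => wd_rot k h)
  have h3 : C.sum (fun γ a => a • g γ) = qNat k (FreeA k d) f := by
    simp only [C]
    rw [Finsupp.sum_mapDomain_index (by simp) (by intros; simp [add_smul])]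
    conv_rhs => rw [hexp]
    simp only [Finsupp.sum, map_sum, map_smul]
    rfl
  rw [← h3, hC]; simp
end

/-! ### Polynomial functions -/

section
variable {k : Type*} [Field k] [CharZero k]

/-- A polynomial vanishing on a translate of an additive monoid vanishes on the translate of its
span. -/
theorem poly_span {I : Type*} (P : MvPolynomial I k) (S : AddSubmonoid (I → k)) (x : I → k)
    (h : ∀ s ∈ S, MvPolynomial.eval (x + s) P = 0) (v : I → k)
    (hv : v ∈ Submodule.span k (S : Set (I → k))) : MvPolynomial.eval (x + v) P = 0 := by
  have key : ∀ v ∈ Submodule.span k (S : Set (I → k)), ∀ (c : k) (x : I → k),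
      (∀ s ∈ S, MvPolynomial.eval (x + s) P = 0) →
      (∀ s ∈ S, MvPolynomial.eval (x + c • v + s) P = 0) := by
    intro v hv
    induction hv using Submodule.span_induction with
    | mem v hv =>
      intro c x hx s hs
      let Q : Polynomial k := MvPolynomial.eval₂ Polynomial.C
        (fun i => Polynomial.C (x i + s i) + Polynomial.X * Polynomial.C (v i)) P
      have hQ : ∀ t : k, Q.eval t = MvPolynomial.eval (x + t • v + s) P := by
        intro t
        have : (Polynomial.evalRingHom t).comp (MvPolynomial.eval₂Hom Polynomial.C
            (fun i => Polynomial.C (x i + s i) + Polynomial.X * Polynomial.C (v i))) =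
            MvPolynomial.eval (x + t • v + s) := by
          apply MvPolynomial.ringHom_ext
          · intro a; simp
          · intro i; simp; ring
        exact congrArg (fun f => f P) this
      have hQ0 : Q = 0 := by
        apply Polynomial.eq_zero_of_infinite_isRoot
        refine Set.Infinite.mono ?_ (Set.infinite_range_of_injective (Nat.cast_injective (R := k)))
        rintro _ ⟨m, rfl⟩
        change Q.eval (m : k) = 0
        rw [hQ, add_assoc]
        apply hx
        rw [Nat.cast_smul_eq_nsmul]
        exact S.add_mem (S.nsmul_mem hv m) hs
      rw [← hQ, hQ0, Polynomial.eval_zero]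
    | zero => intro c x hx s hs; simpa using hx s hs
    | add a b _ _ ha hb =>
      intro c x hx s hs
      rw [smul_add, ← add_assoc x]
      exact hb c _ (ha c x hx) s hs
    | smul r a _ ha =>
      intro c x hx s hs
      rw [smul_smul]
      exact ha _ x hx s hs
  simpa using key v hv 1 x h 0 S.zero_mem

theorem poly_zero {I V : Type*} [AddCommGroup V] [Module k V] (b : Basis I k V)
    (P : MvPolynomial I k) (S : AddSubmonoid (V →ₗ[k] k))
    (hS : ∀ v : V, (∀ χ ∈ S, χ v = 0) → v = 0) (χ₀ : V →ₗ[k] k)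
    (h : ∀ χ ∈ S, MvPolynomial.eval (fun i => (χ₀ + χ) (b i)) P = 0) : P = 0 := by
  classical
  let r : (V →ₗ[k] k) →ₗ[k] (I → k) := 
    { toFun := fun χ i => χ (b i), map_add' := fun _ _ => rfl, map_smul' := fun _ _ => rfl }
  let T : AddSubmonoid (I → k) := S.map r.toAddMonoidHom
  have h1 : ∀ v ∈ Submodule.span k (T : Set (I → k)), MvPolynomial.eval (r χ₀ + v) P = 0 := by
    apply poly_span
    rintro _ ⟨χ, hχ, rfl⟩
    exact h χ hχ
  -- restriction to finitely many variables
  let res : (I → k) →ₗ[k] (P.vars → k) := LinearMap.funLeft k k (fun j : P.vars => (j : I))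
  have h2 : (Submodule.span k (T : Set (I → k))).map res = ⊤ := by
    by_contra hne
    obtain ⟨φ, hφ, hφ0⟩ := Submodule.exists_dual_map_eq_bot_of_lt_top (lt_top_iff_ne_top.mpr hne) inferInstance
    apply hφ
    let ε : P.vars → (P.vars → k) := fun j i => if j = i then 1 else 0
    have hrep : ∀ y : P.vars → k, φ y = ∑ j, y j * φ (ε j) := by
      intro y
      exact LinearMap.pi_apply_eq_sum_univ φ y
    have hz : ∑ j : P.vars, φ (ε j) • b j = 0 := by
      apply hS
      intro χ hχ
      have h3 : φ (res (r χ)) = 0 := by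
        have : φ (res (r χ)) ∈ ((Submodule.span k (T : Set (I → k))).map res).map φ :=
          Submodule.mem_map_of_mem (Submodule.mem_map_of_mem (Submodule.subset_span ⟨χ, hχ, rfl⟩))
        rw [hφ0] at this
        exact (Submodule.mem_bot k).mp this
      rw [hrep] at h3
      rw [map_sum, ← h3]
      refine Finset.sum_congr rfl fun j _ => ?_
      rw [map_smul, smul_eq_mul, mul_comm]
      rfl
    have hli := Fintype.linearIndependent_iff.mp
      (b.linearIndependent.comp (fun j : P.vars => (j : I)) Subtype.val_injective) _ hz
    refine LinearMap.ext fun y => ?_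
    rw [hrep]
    simp [hli]
  apply MvPolynomial.funext
  intro y
  have : res (y - r χ₀) ∈ (Submodule.span k (T : Set (I → k))).map res := by rw [h2]; trivial
  obtain ⟨v, hv, hvy⟩ := this
  rw [map_zero, ← h1 v hv]
  apply MvPolynomial.eval₂Hom_congr' rfl _ rfl
  intro i hi _
  have := congrFun hvy ⟨i, hi⟩
  simp only [res, LinearMap.funLeft_apply, Pi.sub_apply] at this
  simp [this]

end

/-! ### The symmetric algebra -/

section
variable {k : Type*} [Field k] {A : Type*} [Ring A] [Algebra k A]

theorem symA_comm (x y : SymA k A) : x * y = y * x := by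
  obtain ⟨x, rfl⟩ := RingQuot.mkAlgHom_surjective k (symRel k A) x
  obtain ⟨y, rfl⟩ := RingQuot.mkAlgHom_surjective k (symRel k A) y
  rw [← map_mul, ← map_mul]
  exact RingQuot.mkAlgHom_rel k ⟨x, y, rfl, rfl⟩

/-- Evaluation of the symmetric algebra at a functional. -/
def symEv (χ : Anat k A →ₗ[k] k) : SymA k A →ₐ[k] k :=
  RingQuot.liftAlgHom k ⟨TensorAlgebra.lift k χ, by
    rintro x y ⟨u, v, rfl, rfl⟩
    simp only [map_mul]
    exact mul_comm _ _⟩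

theorem symEv_iota (χ : Anat k A →ₗ[k] k) (v : Anat k A) : symEv χ (iotaSym k A v) = χ v := by
  simp [symEv, iotaSym]

theorem symA_repr {I : Type*} (b : Basis I k (Anat k A)) (f : SymA k A) :
    ∃ P : MvPolynomial I k,
      (P = 0 → f = 0) ∧ ∀ χ, symEv χ f = MvPolynomial.eval (fun i => χ (b i)) P := by
  let _ : CommRing (SymA k A) := { (inferInstance : Ring (SymA k A)) with mul_comm := symA_comm }
  let φ : MvPolynomial I k →ₐ[k] SymA k A := MvPolynomial.aeval (fun i => iotaSym k A (b i))
  have hφ : Function.Surjective φ := by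
    let ψ : TensorAlgebra k (Anat k A) →ₐ[k] MvPolynomial I k :=
      TensorAlgebra.lift k (b.constr k (fun i => (MvPolynomial.X i : MvPolynomial I k)))
    have hψ : φ.comp ψ = RingQuot.mkAlgHom k (symRel k A) := by
      apply TensorAlgebra.hom_ext
      apply b.ext
      intro i
      simp [φ, ψ, iotaSym]
    intro f
    obtain ⟨x, rfl⟩ := RingQuot.mkAlgHom_surjective k (symRel k A) f
    exact ⟨ψ x, by rw [← hψ]; rfl⟩
  obtain ⟨P, rfl⟩ := hφ f
  refine ⟨P, fun h => by rw [h, map_zero], fun χ => ?_⟩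
  have : (symEv χ).comp φ = MvPolynomial.aeval (fun i => χ (b i)) := by
    apply MvPolynomial.algHom_ext
    intro i
    simp [φ, symEv_iota]
  exact congrArg (fun g => g P) this

end

/-! ### Realizing coefficients by path representations -/

section
variable {k : Type*} [Field k] {d : ℕ}

theorem trNatX_mk (N : ℕ) (X : Fin d → Matrix (Fin N) (Fin N) k) (a : FreeA k d) :
    trNatX k d N X (qNat k (FreeA k d) a) = (rhoG k d X a).trace := rfl

theorem trace_reindex' {ι κ : Type*} [Fintype ι] [Fintype κ] (e : ι ≃ κ) (M : Matrix ι ι k) :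
    (M.reindex e e).trace = M.trace := by
  simp [Matrix.trace, ← Equiv.sum_comp e]

theorem trNatX_sum {ι κ : Type*} [Fintype ι] [DecidableEq ι] [Fintype κ] [DecidableEq κ]
    {N N₁ N₂ : ℕ} (X : Fin d → Matrix ι ι k) (Y : Fin d → Matrix κ κ k)
    (e : ι ⊕ κ ≃ Fin N) (e₁ : ι ≃ Fin N₁) (e₂ : κ ≃ Fin N₂) :
    trNatX k d N (fun p => (Matrix.fromBlocks (X p) 0 0 (Y p)).reindex e e) =
      trNatX k d N₁ (fun p => (X p).reindex e₁ e₁) +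
      trNatX k d N₂ (fun p => (Y p).reindex e₂ e₂) := by
  refine LinearMap.ext fun v => ?_
  obtain ⟨a, rfl⟩ := Submodule.mkQ_surjective _ v
  change trNatX k d N _ (qNat k (FreeA k d) a) = trNatX k d N₁ _ (qNat k (FreeA k d) a) +
    trNatX k d N₂ _ (qNat k (FreeA k d) a)
  rw [trNatX_mk, trNatX_mk, trNatX_mk, rhoG_reindex _ e, rhoG_reindex _ e₁, rhoG_reindex _ e₂,
    trace_reindex', trace_reindex', trace_reindex', rhoG_sum]
  simp [Matrix.trace]

variable (k d) in
/-- The additive monoid of characters. -/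
def charS : AddSubmonoid (Anat k (FreeA k d) →ₗ[k] k) where
  carrier := {χ | ∃ (N : ℕ) (X : Fin d → Matrix (Fin N) (Fin N) k), χ = trNatX k d N X}
  zero_mem' := by
    refine ⟨0, 0, LinearMap.ext fun v => ?_⟩
    obtain ⟨a, rfl⟩ := Submodule.mkQ_surjective _ v
    change 0 = trNatX k d 0 0 (qNat k (FreeA k d) a)
    rw [trNatX_mk]
    simp [Matrix.trace]
  add_mem' := by
    rintro _ _ ⟨N, X, rfl⟩ ⟨M, Y, rfl⟩
    exact ⟨N + M, _, (trNatX_sum X Y finSumFinEquiv (Equiv.refl _) (Equiv.refl _)).symm⟩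

theorem symA_zero [CharZero k] (f : SymA k (FreeA k d)) (χ₀ : Anat k (FreeA k d) →ₗ[k] k)
    (h : ∀ χ ∈ charS k d, symEv (χ₀ + χ) f = 0) : f = 0 := by
  obtain ⟨P, hP, hP'⟩ := symA_repr (Basis.ofVectorSpace k (Anat k (FreeA k d))) f
  apply hP
  refine poly_zero (Basis.ofVectorSpace k (Anat k (FreeA k d))) P (charS k d) ?_ χ₀ ?_
  · intro v hv
    obtain ⟨a, rfl⟩ := Submodule.mkQ_surjective _ v
    exact trace_sep k a (fun N X => hv _ ⟨N, X, rfl⟩)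
  · intro χ hχ
    rw [← hP']
    exact h χ hχ

/-- Vertices of the path representation. -/
abbrev PV (d n L : ℕ) := Option (Fin n) × {l : List (Fin d) // l.length ≤ L}

instance (d n L : ℕ) : Finite (PV d n L) := by
  have : Finite {l : List (Fin d) // l.length ≤ L} := (List.finite_length_le (Fin d) L).to_subtype
  infer_instance

noncomputable instance (d n L : ℕ) : Fintype (PV d n L) := Fintype.ofFinite _

variable (k) in
/-- The path representation. -/
def pathX (n L : ℕ) (p : Fin d) : Matrix (PV d n L) (PV d n L) k :=
  fun x y => if x.1 = y.1 ∧ x.2.1 = p :: y.2.1 then 1 else 0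

theorem pathX_word (n L : ℕ) (v : List (Fin d)) (x y : PV d n L) :
    rhoG k d (pathX k n L) (wd k d v) x y =
      if x.1 = y.1 ∧ x.2.1 = v ++ y.2.1 then 1 else 0 := by
  induction v generalizing x y with
  | nil =>
    rw [rhoG_nil, Matrix.one_apply]
    simp [Prod.ext_iff, Subtype.ext_iff]
  | cons p v ih =>
    rw [rhoG_cons, Matrix.mul_apply]
    simp only [ih, pathX]
    by_cases h : ∃ m, x.2.1 = p :: m
    · obtain ⟨m, hm⟩ := h
      have hl : m.length ≤ L := by
        have := x.2.2
        rw [hm] at this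
        simp at this
        omega
      rw [Finset.sum_eq_single (x.1, ⟨m, hl⟩)]
      · simp [hm]
      · rintro ⟨b1, b2, hb2⟩ _ hb
        rw [if_neg, zero_mul]
        rintro ⟨h1, h2⟩
        apply hb
        rw [hm] at h2
        simp_all
      · simp
    · rw [if_neg, Finset.sum_eq_zero]
      · intro b _
        rw [if_neg, zero_mul]
        rintro ⟨_, h1⟩; exact h ⟨_, h1⟩
      · rintro ⟨_, h1⟩; exact h ⟨v ++ y.2.1, by simpa using h1⟩

theorem pathX_apply (n L : ℕ) (r t : Option (Fin n)) (w : List (Fin d)) (hw : w.length ≤ L)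
    (a : FreeA k d) :
    rhoG k d (pathX k n L) a (r, ⟨w, hw⟩) (t, ⟨[], Nat.zero_le _⟩) =
      if r = t then (wbasis k d).repr a w else 0 := by
  let F : FreeA k d →ₗ[k] k :=
    { toFun := fun a => rhoG k d (pathX k n L) a (r, ⟨w, hw⟩) (t, ⟨[], Nat.zero_le _⟩)
      map_add' := by intros; simp
      map_smul' := by intros; simp }
  let G : FreeA k d →ₗ[k] k := (if r = t then (1 : k) else 0) • (wbasis k d).coord w
  have : F = G := by
    apply (wbasis k d).ext
    intro v
    simp only [F, G, LinearMap.coe_mk, AddHom.coe_mk, LinearMap.smul_apply, Basis.coord_apply,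
      Basis.repr_self]
    rw [wbasis_apply, pathX_word]
    by_cases h : r = t <;> simp [h, Finsupp.single_apply, eq_comm]
  have h2 := LinearMap.congr_fun this a
  simp only [F, G, LinearMap.coe_mk, AddHom.coe_mk, LinearMap.smul_apply, Basis.coord_apply] at h2
  rw [h2]
  split_ifs <;> simp

variable (k d) in
/-- The coefficient in `Sym(A_♮)` of a word tuple and a permutation. -/
def coefE (n : ℕ) : OO k (FreeA k d) n ≃ₗ[k]
    (Equiv.Perm (Fin n) →₀ ((Fin n → List (Fin d)) →₀ SymA k (FreeA k d))) := by
  classical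
  exact (TensorProduct.equivFinsuppOfBasisRight Finsupp.basisSingleOne).trans
    (Finsupp.mapRange.linearEquiv (TensorProduct.equivFinsuppOfBasisLeft
      (Basis.piTensorProduct (fun _ : Fin n => wbasis k d))))

theorem coefE_tmul (n : ℕ) (a : Fin n → FreeA k d) (f : SymA k (FreeA k d))
    (u u₀ : Equiv.Perm (Fin n)) (w₀ : Fin n → List (Fin d)) :
    coefE k d n ((PiTensorProduct.tprod k a ⊗ₜ[k] f) ⊗ₜ[k] Finsupp.single u 1) u₀ w₀ =
      (if u = u₀ then ∏ t, (wbasis k d).repr (a t) (w₀ t) else 0) • f := by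
  classical
  by_cases h : u = u₀ <;> simp [coefE, h, Finsupp.single_apply]

theorem pair_tmul (n N : ℕ) (X : Fin d → Matrix (Fin N) (Fin N) k) (i j : Fin n → Fin N)
    (a : Fin n → FreeA k d) (f : SymA k (FreeA k d)) (u : Equiv.Perm (Fin n)) :
    pairKval k d N X i j ((PiTensorProduct.tprod k a ⊗ₜ[k] f) ⊗ₜ[k] Finsupp.single u 1) =
      (∏ t, rhoG k d X (a t) (i (u⁻¹ t)) (j t)) * symEv (trNatX k d N X) f := by
  simp [pairKval, build]
  rfl

theorem pair_eq (n : ℕ) (u₀ : Equiv.Perm (Fin n)) (w₀ : Fin n → List (Fin d)) :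
    ∃ χ₀ : Anat k (FreeA k d) →ₗ[k] k, ∀ χ ∈ charS k d, ∃ (N : ℕ) (_ : 1 ≤ N)
      (X : Fin d → Matrix (Fin N) (Fin N) k) (i j : Fin n → Fin N), ∀ α : OO k (FreeA k d) n,
      pairKval k d N X i j α = symEv (χ₀ + χ) (coefE k d n α u₀ w₀) := by
  classical
  let L := ∑ t, (w₀ t).length
  have hL : ∀ t, (w₀ t).length ≤ L := fun t =>
    Finset.single_le_sum (f := fun t => (w₀ t).length) (fun _ _ => Nat.zero_le _)
      (Finset.mem_univ t)
  let e₁ := Fintype.equivFin (PV d n L)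
  refine ⟨trNatX k d _ (fun p => (pathX k n L p).reindex e₁ e₁), ?_⟩
  rintro _ ⟨M, Y, rfl⟩
  let e := Fintype.equivFin (PV d n L ⊕ Fin M)
  have htr := trNatX_sum (pathX k n L) Y e e₁ (Equiv.refl _)
  refine ⟨_, Fintype.card_pos_iff.mpr ⟨Sum.inl (none, ⟨[], Nat.zero_le _⟩)⟩,
    fun p => (Matrix.fromBlocks (pathX k n L p) 0 0 (Y p)).reindex e e,
    fun r => e (Sum.inl (some (u₀ r), ⟨w₀ (u₀ r), hL _⟩)),
    fun t => e (Sum.inl (some t, ⟨[], Nat.zero_le _⟩)), ?_⟩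
  intro α
  let F : OO k (FreeA k d) n →ₗ[k] k :=
    (symEv (trNatX k d _ (fun p => (pathX k n L p).reindex e₁ e₁) + trNatX k d M Y)).toLinearMap ∘ₗ
      Finsupp.lapply w₀ ∘ₗ Finsupp.lapply u₀ ∘ₗ (coefE k d n).toLinearMap
  suffices h : pairKval k d _ (fun p => (Matrix.fromBlocks (pathX k n L p) 0 0 (Y p)).reindex e e)
      (fun r => e (Sum.inl (some (u₀ r), ⟨w₀ (u₀ r), hL _⟩)))
      (fun t => e (Sum.inl (some t, ⟨[], Nat.zero_le _⟩))) = F from LinearMap.congr_fun h α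
  have hpure : ∀ (a : Fin n → FreeA k d) (f : SymA k (FreeA k d)) (u : Equiv.Perm (Fin n)),
    pairKval k d _ (fun p => (Matrix.fromBlocks (pathX k n L p) 0 0 (Y p)).reindex e e)
      (fun r => e (Sum.inl (some (u₀ r), ⟨w₀ (u₀ r), hL _⟩)))
      (fun t => e (Sum.inl (some t, ⟨[], Nat.zero_le _⟩)))
      ((PiTensorProduct.tprod k a ⊗ₜ[k] f) ⊗ₜ[k] Finsupp.single u 1) =
    F ((PiTensorProduct.tprod k a ⊗ₜ[k] f) ⊗ₜ[k] Finsupp.single u 1) := by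
    intro a f u
    rw [pair_tmul, htr]
    simp only [F, LinearMap.comp_apply, LinearEquiv.coe_coe, Finsupp.lapply_apply,
      AlgHom.toLinearMap_apply, coefE_tmul, map_smul, smul_eq_mul]
    refine congrArg₂ (· * ·) ?_ rfl
    have hent : ∀ (b : FreeA k d) (r t : Fin n),
        rhoG k d (fun p => (Matrix.fromBlocks (pathX k n L p) 0 0 (Y p)).reindex e e) b
          (e (Sum.inl (some r, ⟨w₀ r, hL _⟩))) (e (Sum.inl (some t, ⟨[], Nat.zero_le _⟩))) =
        if some r = some t then (wbasis k d).repr b (w₀ r) else 0 := by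
      intro b r t
      rw [rhoG_reindex (fun p => Matrix.fromBlocks (pathX k n L p) 0 0 (Y p)) e, rhoG_sum,
        Matrix.reindex_apply, Matrix.submatrix_apply, Equiv.symm_apply_apply,
        Equiv.symm_apply_apply, Matrix.fromBlocks_apply₁₁, pathX_apply]
    refine (Finset.prod_congr rfl fun t _ => hent (a t) (u₀ (u⁻¹ t)) t).trans ?_
    by_cases hu : u = u₀
    · subst hu
      simp
    · rw [if_neg hu]
      have : ∃ t, u₀ (u⁻¹ t) ≠ t := by
        by_contra hcon
        push Not at hcon
        apply hu
        ext1 r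
        have := hcon (u r)
        simpa using this.symm
      obtain ⟨t, ht⟩ := this
      apply Finset.prod_eq_zero (Finset.mem_univ t)
      rw [if_neg]
      simpa using ht
  refine TensorProduct.ext' fun x y => ?_
  induction y using Finsupp.induction_linear with
  | zero => simp only [tmul_zero, map_zero]
  | add y z hy hz => simp only [tmul_add, map_add, hy, hz]
  | single u c =>
    rw [← mul_one c, ← smul_eq_mul, ← Finsupp.smul_single, tmul_smul, map_smul, map_smul]
    congr 1
    induction x using TensorProduct.induction_on with
    | zero => simp only [zero_tmul, map_zero]
    | add y z hy hz => simp only [add_tmul, map_add, hy, hz]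
    | tmul x f =>
      induction x using PiTensorProduct.induction_on with
      | smul_tprod r a =>
        rw [← smul_tmul', ← smul_tmul', map_smul, map_smul, hpure]
      | add x y hx hy => simp only [add_tmul, map_add, hx, hy]
end

end Helpers

/-!
Statement 12: for the free algebra `A = k⟨x_1,…,x_d⟩` (`k` algebraically closed of
characteristic zero, `d ≥ 1`) and any `n ≥ 0`: if `α ∈ O(A)^{(n)}` satisfies `α_{ij}(X) = 0`
for all `N ≥ 1`, all tuples `i, j ∈ {1,…,N}^n` and all `X ∈ Mat_N(k)^d`, then `α = 0`.
-/

theorem eval_all_reps_zero_implies_zero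
    (kk : Type*) [Field kk] [IsAlgClosed kk] [CharZero kk]
    (d : ℕ) (hd : 1 ≤ d) (n : ℕ) (α : OO kk (FreeA kk d) n)
    (hvanish : ∀ (N : ℕ), 1 ≤ N → ∀ (X : Fin d → Matrix (Fin N) (Fin N) kk)
      (i j : Fin n → Fin N), pairKval kk d N X i j α = 0) :
    α = 0 := by
  apply (coefE kk d n).injective
  rw [map_zero]
  ext1 u₀
  ext1 w₀
  obtain ⟨χ₀, hχ₀⟩ := pair_eq (k := kk) (d := d) n u₀ w₀
  refine symA_zero _ χ₀ fun χ hχ => ?_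
  obtain ⟨N, hN, X, i, j, h⟩ := hχ₀ χ hχ
  rw [← h α]
  exact hvanish N hN X i j

end
end
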